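/- arXiv:1606.05236 — 3 statements merged into one kernel-verified Lean document; each statement's English description precedes it below -/
import Mathlib

section
/- Let $E$ be a symmetric operator on a dense domain $\mathcal{D}$ of a Hilbert space. Let $\{d_i\}$ and $\{\lambda_i\}$ be nondecreasing real sequences with $\delta_k := \sum_{i=1}^k(d_i - \lambda_i) \ge 0$ for all $k$ and $\liminf_{k\to\infty}\delta_k = 0$. If $E$ has diagonal $\{\lambda_i\}$ with respect to an orthonormal sequence $\{f_i\} \subset \mathcal{D}$, then there exists an orthonormal sequence $\{e_i\}$, with each $e_k$ in the algebraic span of $\{f_i\}$ and with the same closed linear span, such that $\langle Ee_i, e_i\rangle = d_i$ for all $i$. (No unboundedness of $\{\lambda_i\}$ is assumed.) -/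
open Filter
open scoped InnerProductSpace ComplexConjugate

/-- The partial sums `∑ i < k, (d i - lam i)`. -/
noncomputable def excess (d lam : ℕ → ℝ) (k : ℕ) : ℝ := ∑ i ∈ Finset.range k, (d i - lam i)

lemma excess_succ (d lam : ℕ → ℝ) (k : ℕ) :
    excess d lam (k + 1) = excess d lam k + (d k - lam k) :=
  Finset.sum_range_succ _ _

lemma excess_add (d lam : ℕ → ℝ) (a k : ℕ) :
    excess d lam (a + k) = excess d lam a + ∑ i ∈ Finset.range k, (d (a + i) - lam (a + i)) :=
  Finset.sum_range_add _ _ _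

lemma exists_le_forall_Ioc_le (S : ℕ → ℝ) {K k : ℕ} (hk : K < k) :
    ∃ K', K < K' ∧ S K' ≤ S k ∧ ∀ l ∈ Set.Ioc K K', S K' ≤ S l := by
  obtain ⟨m, hm, hmin⟩ := Finset.exists_min_image (Finset.Ioc K k) S ⟨k, by simp [hk]⟩
  rw [Finset.mem_Ioc] at hm
  refine ⟨m, hm.1, hmin k (by simp [hk]), fun l hl => hmin l ?_⟩
  exact Finset.mem_Ioc.2 ⟨hl.1, hl.2.trans hm.2⟩

/-- Block endpoints: after any `K` there is a `K'` at which the excess is small and minimal on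
`(K, K']`, and such that moving mass `excess K' - excess K` onto `lam K` does not
exceed `lam K'`. -/
lemma exists_block_end {d lam : ℕ → ℝ} (hd : Monotone d) (hlam : Monotone lam)
    (hδ : ∀ k, 0 ≤ excess d lam k)
    (hfreq : ∀ ε > 0, ∀ N, ∃ k > N, excess d lam k < ε) (K : ℕ) {ε : ℝ} (hε : 0 < ε) :
    ∃ K', K < K' ∧ (∀ l ∈ Set.Ioc K K', excess d lam K' ≤ excess d lam l) ∧
      excess d lam K' ≤ ε ∧ lam K + excess d lam K' - excess d lam K ≤ lam K' := by
  set S := excess d lam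
  by_cases hA : ∃ k > K, S k ≤ ε ∧ S k ≤ S K
  · obtain ⟨k, hk, hkε, hkK⟩ := hA
    obtain ⟨K', hK', hle, hmin⟩ := exists_le_forall_Ioc_le S hk
    exact ⟨K', hK', hmin, hle.trans hkε, by linarith [hlam hK'.le]⟩
  push Not at hA
  have hSK : S K = 0 := by
    by_contra hne
    have hpos : 0 < S K := lt_of_le_of_ne (hδ K) (Ne.symm hne)
    obtain ⟨k, hk, hlt⟩ := hfreq (min ε (S K)) (lt_min hε hpos) K
    have := hA k hk (hlt.le.trans (min_le_left _ _))
    exact absurd (hlt.trans_le (min_le_right _ _)) this.le.not_gt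
  have hpos : ∀ k > K, 0 < S k := fun k hk => by
    by_cases h : S k ≤ ε
    · exact hSK ▸ hA k hk h
    · linarith
  obtain ⟨M, hKM, hM⟩ : ∃ M > K, lam K < lam M := by
    by_contra! hc
    have hdK : 0 < d K - lam K := by
      have := hpos (K + 1) (Nat.lt_succ_self K)
      rwa [show S (K + 1) = _ from excess_succ d lam K, show excess d lam K = 0 from hSK,
        zero_add] at this
    have hge : ∀ k ≥ K + 1, S (K + 1) ≤ S k := fun k hk => by
      induction k, hk using Nat.le_induction with
      | base => exact le_rfl
      | succ k hk ih =>
        rw [show S (k + 1) = S k + _ from excess_succ d lam k]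
        linarith [hd (show K ≤ k by omega), hc k hk]
    obtain ⟨k, hk, hlt⟩ := hfreq _ (hpos (K + 1) (Nat.lt_succ_self K)) K
    exact absurd (hge k hk) hlt.not_ge
  obtain ⟨m, hm, hmin⟩ := Finset.exists_min_image (Finset.Ioc K M) S ⟨M, by simp [hKM]⟩
  have hSm : 0 < S m := hpos m (Finset.mem_Ioc.1 hm).1
  obtain ⟨k, hk, hlt⟩ := hfreq (min (S m) (min ε (lam M - lam K)))
    (lt_min hSm (lt_min hε (sub_pos.2 hM))) K
  obtain ⟨K', hK', hle, hblock⟩ := exists_le_forall_Ioc_le S hk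
  have hltK' := hle.trans_lt hlt
  rw [lt_min_iff, lt_min_iff] at hltK'
  have hMK' : M ≤ K' := by
    by_contra h
    have := hmin K' (Finset.mem_Ioc.2 ⟨hK', by omega⟩)
    linarith
  exact ⟨K', hK', hblock, hltK'.2.1.le, by linarith [hlam hMK']⟩

section Rebasing

variable {V : Type*} [NormedAddCommGroup V] [InnerProductSpace ℂ V]

/-- `u'` is an orthonormal sequence that arises from `u` by a change of basis of the span of
`u '' s`. -/
structure IsRebasing (s : Set ℕ) (u u' : ℕ → V) : Prop where
  orthonormal : Orthonormal ℂ u'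
  eq_off : ∀ i ∉ s, u' i = u i
  mem_span : ∀ i, u' i ∈ Submodule.span ℂ (Set.range u)
  mem_span_image : ∀ i ∈ s, u i ∈ Submodule.span ℂ (u' '' s)

namespace IsRebasing

variable {s t : Set ℕ} {u v w : ℕ → V}

lemma refl (s : Set ℕ) (hu : Orthonormal ℂ u) : IsRebasing s u u where
  orthonormal := hu
  eq_off _ _ := rfl
  mem_span i := Submodule.subset_span ⟨i, rfl⟩
  mem_span_image i hi := Submodule.subset_span ⟨i, hi, rfl⟩

lemma mono (h : IsRebasing s u v) (hst : s ⊆ t) : IsRebasing t u v where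
  orthonormal := h.orthonormal
  eq_off i hi := h.eq_off i fun his => hi (hst his)
  mem_span := h.mem_span
  mem_span_image i hi := by
    by_cases his : i ∈ s
    · exact Submodule.span_mono (Set.image_mono hst) (h.mem_span_image i his)
    · exact Submodule.subset_span ⟨i, hi, h.eq_off i his⟩

lemma trans (h : IsRebasing s u v) (h' : IsRebasing s v w) : IsRebasing s u w where
  orthonormal := h'.orthonormal
  eq_off i hi := (h'.eq_off i hi).trans (h.eq_off i hi)
  mem_span i := by
    refine Submodule.span_le.2 ?_ (h'.mem_span i)
    rintro _ ⟨j, rfl⟩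
    exact h.mem_span j
  mem_span_image i hi := by
    refine Submodule.span_le.2 ?_ (h.mem_span_image i hi)
    rintro _ ⟨j, hj, rfl⟩
    exact h'.mem_span_image j hj

end IsRebasing

lemma exists_norm_eq_one_mul_add_conj_eq_zero (z : ℂ) :
    ∃ ω : ℂ, ‖ω‖ = 1 ∧ ω * z + conj (ω * z) = 0 := by
  by_cases hz : z = 0
  · exact ⟨1, by simp, by simp [hz]⟩
  refine ⟨Complex.I * (conj z / ‖z‖), by simp [hz], ?_⟩
  have h : Complex.I * (conj z / ‖z‖) * z = Complex.I * ((‖z‖ : ℝ) : ℂ) := by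
    have : (‖z‖ : ℂ) ≠ 0 := by simpa using hz
    field_simp
    rw [mul_comm]
    exact Complex.mul_conj' z
  rw [h]
  simp

/-- Rotating two members of an orthonormal sequence moves the diagonal of a Hermitian form by any
prescribed convex amount. -/
lemma exists_rotation (B : V →ₗ⋆[ℂ] V →ₗ[ℂ] ℂ) (hB : ∀ x y, B y x = conj (B x y))
    {u : ℕ → V} (hu : Orthonormal ℂ u) {p r : ℕ} (hpr : p ≠ r) {a b t : ℝ}
    (ha : B (u p) (u p) = a) (hb : B (u r) (u r) = b) (hat : a ≤ t) (htb : t ≤ b) :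
    ∃ (u' : ℕ → V) (β : ℂ), IsRebasing {p, r} u u' ∧ B (u' p) (u' p) = t ∧
      B (u' r) (u' r) = (a + b - t : ℝ) ∧ u p - β • u' r ∈ Submodule.span ℂ {u' p} ∧
      ‖β‖ ^ 2 * (b - a) = t - a ∧ (t = a → β = 0) := by
  obtain ⟨ω, hω, hz⟩ := exists_norm_eq_one_mul_add_conj_eq_zero (B (u p) (u r))
  have hωω : conj ω * ω = 1 := by
    rw [mul_comm]; exact (Complex.mul_conj' ω).trans (by simp [hω])
  set σ : ℝ := √((t - a) / (b - a))
  have hσ : σ ^ 2 = (t - a) / (b - a) := Real.sq_sqrt (div_nonneg (by linarith) (by linarith))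
  have hσ1 : σ ^ 2 ≤ 1 := hσ ▸ div_le_one_of_le₀ (by linarith) (by linarith)
  have hσab : σ ^ 2 * (b - a) = t - a := by
    rw [hσ]
    by_cases hab : b - a = 0
    · rw [hab]; linarith
    · exact div_mul_cancel₀ _ hab
  set c : ℝ := √(1 - σ ^ 2)
  have hc : c ^ 2 = 1 - σ ^ 2 := Real.sq_sqrt (by linarith)
  have hcC : (c : ℂ) ^ 2 = 1 - (σ : ℂ) ^ 2 := by exact_mod_cast hc
  have hσC : (σ : ℂ) ^ 2 * (b - a) = t - a := by exact_mod_cast hσab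
  set x : V := (c : ℂ) • u p + (σ * ω : ℂ) • u r with hx
  set y : V := (σ : ℂ) • u p - (c * ω : ℂ) • u r with hy
  have hxy : u p = (c : ℂ) • x + (σ : ℂ) • y := by
    rw [hx, hy]; match_scalars
    · linear_combination -hcC
    · ring
  have hyx : u r = (conj ω * σ : ℂ) • x - (conj ω * c : ℂ) • y := by
    rw [hx, hy]; match_scalars
    · linear_combination -(hωω) * ((σ : ℂ) ^ 2 + (c : ℂ) ^ 2) - hcC
    · ring
  set u' : ℕ → V := fun i => if i = p then x else if i = r then y else u i
  have hp : u' p = x := by simp [u']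
  have hr : u' r = y := by simp [u', hpr.symm]
  have hoff : ∀ i, i ≠ p → i ≠ r → u' i = u i := fun i h1 h2 => by simp [u', h1, h2]
  have hin := orthonormal_iff_ite.1 hu
  have hpmem : u p ∈ Submodule.span ℂ (Set.range u) := Submodule.subset_span ⟨p, rfl⟩
  have hrmem : u r ∈ Submodule.span ℂ (Set.range u) := Submodule.subset_span ⟨r, rfl⟩
  refine ⟨u', σ, ⟨?_, ?_, ?_, ?_⟩, ?_, ?_, ?_, ?_, ?_⟩
  · rw [orthonormal_iff_ite]
    have hxx : ⟪x, x⟫_ℂ = 1 := by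
      simp only [hx, inner_add_left, inner_add_right, inner_smul_left, inner_smul_right, hin, hpr,
        hpr.symm, map_mul, Complex.conj_ofReal, if_true, if_false]
      linear_combination hcC + (σ : ℂ) ^ 2 * hωω
    have hyy : ⟪y, y⟫_ℂ = 1 := by
      simp only [hy, inner_sub_left, inner_sub_right, inner_smul_left, inner_smul_right, hin, hpr,
        hpr.symm, map_mul, Complex.conj_ofReal, if_true, if_false]
      linear_combination hcC + (c : ℂ) ^ 2 * hωω
    have hxy0 : ⟪x, y⟫_ℂ = 0 := by
      simp only [hx, hy, inner_add_left, inner_sub_right, inner_smul_left, inner_smul_right, hin,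
        hpr, hpr.symm, map_mul, Complex.conj_ofReal, if_true, if_false]
      linear_combination -(σ * c : ℂ) * hωω
    have hyx0 : ⟪y, x⟫_ℂ = 0 := inner_eq_zero_symm.1 hxy0
    have hx0 : ∀ j, j ≠ p → j ≠ r → ⟪x, u j⟫_ℂ = 0 := fun j h1 h2 => by
      simp only [hx, inner_add_left, inner_smul_left, hin, h1.symm, h2.symm, if_false, mul_zero,
        add_zero]
    have hy0 : ∀ j, j ≠ p → j ≠ r → ⟪y, u j⟫_ℂ = 0 := fun j h1 h2 => by
      simp only [hy, inner_sub_left, inner_smul_left, hin, h1.symm, h2.symm, if_false, mul_zero,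
        sub_zero]
    have h0x : ∀ j, j ≠ p → j ≠ r → ⟪u j, x⟫_ℂ = 0 := fun j h1 h2 =>
      inner_eq_zero_symm.1 (hx0 j h1 h2)
    have h0y : ∀ j, j ≠ p → j ≠ r → ⟪u j, y⟫_ℂ = 0 := fun j h1 h2 =>
      inner_eq_zero_symm.1 (hy0 j h1 h2)
    intro i j
    rcases eq_or_ne i p with rfl | hip
    · rcases eq_or_ne j i with rfl | hjp
      · rw [hp, hxx, if_pos rfl]
      rcases eq_or_ne j r with rfl | hjr
      · simp [hp, hr, hxy0, hpr]
      · simp [hp, hoff j hjp hjr, hx0 j hjp hjr, hjp.symm]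
    rcases eq_or_ne i r with rfl | hir
    · rcases eq_or_ne j p with rfl | hjp
      · simp [hp, hr, hyx0, hip]
      rcases eq_or_ne j i with rfl | hjr
      · rw [hr, hyy, if_pos rfl]
      · simp [hr, hoff j hjp hjr, hy0 j hjp hjr, hjr.symm]
    rw [hoff i hip hir]
    rcases eq_or_ne j p with rfl | hjp
    · simp [hp, h0x i hip hir, hip]
    rcases eq_or_ne j r with rfl | hjr
    · simp [hr, h0y i hip hir, hir]
    rw [hoff j hjp hjr, hin]
  · intro i hi
    simp only [Set.mem_insert_iff, Set.mem_singleton_iff, not_or] at hi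
    exact hoff i hi.1 hi.2
  · intro i
    rcases eq_or_ne i p with rfl | hip
    · rw [hp]
      exact add_mem (Submodule.smul_mem _ _ hpmem) (Submodule.smul_mem _ _ hrmem)
    rcases eq_or_ne i r with rfl | hir
    · rw [hr]
      exact sub_mem (Submodule.smul_mem _ _ hpmem) (Submodule.smul_mem _ _ hrmem)
    · rw [hoff i hip hir]
      exact Submodule.subset_span ⟨i, rfl⟩
  · have hxmem : x ∈ Submodule.span ℂ (u' '' {p, r}) := Submodule.subset_span ⟨p, by simp, hp⟩
    have hymem : y ∈ Submodule.span ℂ (u' '' {p, r}) := Submodule.subset_span ⟨r, by simp, hr⟩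
    rintro i (rfl | rfl)
    · rw [hxy]
      exact add_mem (Submodule.smul_mem _ _ hxmem) (Submodule.smul_mem _ _ hymem)
    · rw [hyx]
      exact sub_mem (Submodule.smul_mem _ _ hxmem) (Submodule.smul_mem _ _ hymem)
  · rw [hp, hx]
    simp only [map_add, LinearMap.add_apply, LinearMap.map_smulₛₗ, LinearMap.smul_apply, map_mul,
      Complex.conj_ofReal, smul_eq_mul, ha, hb, hB (u p) (u r), RingHom.id_apply] at hz ⊢
    linear_combination (a : ℂ) * hcC + hσC + (σ : ℂ) ^ 2 * b * hωω + (c * σ : ℂ) * hz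
  · rw [hr, hy]
    simp only [map_sub, LinearMap.sub_apply, LinearMap.map_smulₛₗ, LinearMap.smul_apply, map_mul,
      Complex.conj_ofReal, smul_eq_mul, ha, hb, hB (u p) (u r), RingHom.id_apply] at hz ⊢
    push_cast
    linear_combination (b : ℂ) * hcC - hσC + (c : ℂ) ^ 2 * b * hωω - (c * σ : ℂ) * hz
  · rw [hp, hr]
    refine Submodule.mem_span_singleton.2 ⟨c, ?_⟩
    rw [eq_sub_iff_add_eq, ← hxy]
  · simpa using hσab
  · rintro rfl
    simp [σ]

/-- Finite Schur–Horn theorem on the block `[a, a + n)`: a nondecreasing sequence majorized by the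
diagonal of a Hermitian form is the diagonal with respect to another basis of the block. -/
lemma exists_isRebasing_of_majorized (B : V →ₗ⋆[ℂ] V →ₗ[ℂ] ℂ) (hB : ∀ x y, B y x = conj (B x y))
    {d : ℕ → ℝ} (hd : Monotone d) (n : ℕ) :
    ∀ (a : ℕ) (u : ℕ → V) (μ : ℕ → ℝ), Orthonormal ℂ u →
      (∀ i ∈ Set.Ico a (a + n), B (u i) (u i) = μ i) →
      (∀ k ≤ n, ∑ i ∈ Finset.range k, μ (a + i) ≤ ∑ i ∈ Finset.range k, d (a + i)) →
      ∑ i ∈ Finset.range n, μ (a + i) = ∑ i ∈ Finset.range n, d (a + i) →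
      ∃ u', IsRebasing (Set.Ico a (a + n)) u u' ∧
        ∀ i ∈ Set.Ico a (a + n), B (u' i) (u' i) = d i := by
  induction n with
  | zero => exact fun a u μ hu _ _ _ => ⟨u, .refl _ hu, by simp⟩
  | succ n ih =>
    intro a u μ hu hμ hle heq
    have hμa : μ a ≤ d a := by simpa using hle 1 (by omega)
    obtain ⟨v, ν, hv, hva, hνv, hνle, hνeq⟩ : ∃ (v : ℕ → V) (ν : ℕ → ℝ),
        IsRebasing (Set.Ico a (a + (n + 1))) u v ∧ B (v a) (v a) = d a ∧
        (∀ i ∈ Set.Ico (a + 1) (a + 1 + n), B (v i) (v i) = ν i) ∧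
        (∀ k ≤ n, ∑ i ∈ Finset.range k, ν (a + 1 + i) ≤ ∑ i ∈ Finset.range k, d (a + 1 + i)) ∧
        ∑ i ∈ Finset.range n, ν (a + 1 + i) = ∑ i ∈ Finset.range n, d (a + 1 + i) := by
      have hshift : ∀ (g : ℕ → ℝ) k, ∑ i ∈ Finset.range (k + 1), g (a + i) =
          ∑ i ∈ Finset.range k, g (a + 1 + i) + g a := fun g k => by
        rw [Finset.sum_range_succ']
        simp [add_assoc, add_comm 1]
      have hex : ∃ p, p < n + 1 ∧ d a ≤ μ (a + p) := by
        by_contra! hc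
        refine heq.not_lt (Finset.sum_lt_sum_of_nonempty (by simp) fun i hi => ?_)
        exact (hc i (Finset.mem_range.1 hi)).trans_le (hd (Nat.le_add_right a i))
      classical
      obtain ⟨hpn, hp⟩ := Nat.find_spec hex
      have hmin : ∀ i < Nat.find hex, μ (a + i) < d a := fun i hi => by
        by_contra! h
        exact Nat.find_min hex hi ⟨hi.trans hpn, h⟩
      generalize Nat.find hex = p at hpn hp hmin
      rcases Nat.eq_zero_or_pos p with rfl | hp0
      · have hμd : μ a = d a := le_antisymm hμa hp
        refine ⟨u, μ, .refl _ hu, ?_, fun i hi => hμ i ⟨?_, ?_⟩, fun k hk => ?_, ?_⟩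
        · rw [hμ a ⟨le_rfl, by omega⟩, hμd]
        · have := hi.1; omega
        · have := hi.2; omega
        · have := hle (k + 1) (by omega)
          rw [hshift, hshift, hμd] at this
          linarith
        · rw [hshift, hshift, hμd] at heq
          linarith
      · obtain ⟨v, -, hv, hva, hvp, -⟩ := exists_rotation B hB hu (show a ≠ a + p by omega)
          (hμ a ⟨le_rfl, by omega⟩) (hμ (a + p) ⟨by omega, by omega⟩) hμa hp
        set ν : ℕ → ℝ := fun i => μ i + if i = a + p then μ a - d a else 0 with hν
        have hsum : ∀ k, p ≤ k → ∑ i ∈ Finset.range k, ν (a + 1 + i) =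
            ∑ i ∈ Finset.range (k + 1), μ (a + i) - d a := fun k hk => by
          have : ∀ i, (a + 1 + i = a + p) ↔ i = p - 1 := fun i => by omega
          rw [hshift, hν]
          simp only [this]
          rw [Finset.sum_add_distrib, Finset.sum_ite_eq', if_pos (Finset.mem_range.2 (by omega))]
          ring
        refine ⟨v, ν, hv.mono ?_, hva, fun i hi => ?_, fun k hk => ?_, ?_⟩
        · rintro i (rfl | rfl)
          · exact ⟨le_rfl, by omega⟩
          · exact ⟨by omega, by omega⟩
        · have h1 := hi.1
          have h2 := hi.2
          by_cases hip : i = a + p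
          · subst hip
            rw [hvp, hν]
            simp only [if_true]
            congr 1
            ring
          · rw [hv.eq_off i (by rintro (h | h) <;> [omega; exact hip h]), hμ i ⟨by omega, by omega⟩]
            simp [hν, hip]
        · rcases lt_or_ge k p with hkp | hkp
          · refine Finset.sum_le_sum fun i hi => ?_
            have hik := Finset.mem_range.1 hi
            have hne : a + 1 + i ≠ a + p := by omega
            have := hmin (1 + i) (by omega)
            simp only [hν, hne, if_false, add_zero]
            rw [← add_assoc] at this
            exact this.le.trans (hd (by omega))
          · rw [hsum k hkp]
            have := hle (k + 1) (by omega)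
            rw [hshift d] at this
            linarith
        · rw [hsum n (by omega), heq, hshift]
          ring
    obtain ⟨w, hw, hwd⟩ := ih (a + 1) v ν hv.orthonormal hνv hνle hνeq
    have hsub : Set.Ico (a + 1) (a + 1 + n) ⊆ Set.Ico a (a + (n + 1)) :=
      Set.Ico_subset_Ico (by omega) (by omega)
    refine ⟨w, hv.trans (hw.mono hsub), fun i hi => ?_⟩
    rcases eq_or_ne i a with rfl | hia
    · rw [hw.eq_off i (by simp), hva]
    · exact hwd i ⟨by have := hi.1; omega, by have := hi.2; omega⟩

/-- One stage of the construction: the block `[K, K')` receives its final diagonal, and the mass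
which `u K` has outside the new block is carried by the vector `u' K'`. -/
lemma exists_block_step (B : V →ₗ⋆[ℂ] V →ₗ[ℂ] ℂ) (hB : ∀ x y, B y x = conj (B x y))
    {d lam : ℕ → ℝ} (hd : Monotone d) (hlam : Monotone lam) (hδ : ∀ k, 0 ≤ excess d lam k)
    {K K' : ℕ} (hK : K < K') (hmin : ∀ l ∈ Set.Ioc K K', excess d lam K' ≤ excess d lam l)
    (hle : lam K + excess d lam K' - excess d lam K ≤ lam K')
    {u : ℕ → V} (hu : Orthonormal ℂ u)
    (huK : B (u K) (u K) = (lam K - excess d lam K : ℝ))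
    (hui : ∀ i > K, B (u i) (u i) = lam i) :
    ∃ (u' : ℕ → V) (β : ℂ), IsRebasing (Set.Icc K K') u u' ∧
      (∀ i ∈ Set.Ico K K', B (u' i) (u' i) = d i) ∧
      B (u' K') (u' K') = (lam K' - excess d lam K' : ℝ) ∧
      u K - β • u' K' ∈ Submodule.span ℂ (u' '' Set.Ico K K') ∧
      ‖β‖ ^ 2 * excess d lam K ≤ excess d lam K' ∧ (excess d lam K' = 0 → β = 0) := by
  set S := excess d lam
  obtain ⟨v, β, hv, hvK, hvK', hβ, hβn, hβ0⟩ := exists_rotation B hB hu hK.ne huK (hui K' hK)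
    (t := lam K + S K' - S K) (by linarith [hδ K']) hle
  obtain ⟨n, rfl⟩ := Nat.exists_eq_add_of_lt hK
  rw [add_assoc] at *
  set μ : ℕ → ℝ := fun i => lam i + if i = K then S (K + (n + 1)) - S K else 0 with hμ
  have hsum : ∀ k, ∑ i ∈ Finset.range (k + 1), μ (K + i) =
      ∑ i ∈ Finset.range (k + 1), d (K + i) - (S (K + (k + 1)) - S (K + (n + 1))) := fun k => by
    have h := excess_add d lam K (k + 1)
    rw [Finset.sum_sub_distrib] at h
    simp only [hμ, Nat.add_eq_left]
    rw [Finset.sum_add_distrib, Finset.sum_ite_eq', if_pos (by simp)]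
    linarith
  obtain ⟨w, hw, hwd⟩ := exists_isRebasing_of_majorized B hB hd (n + 1) K v μ hv.orthonormal
    (fun i hi => by
      rcases eq_or_ne i K with rfl | hiK
      · rw [hvK, hμ]
        simp only [if_true]
        congr 1
        ring
      · have h1 := hi.1
        have h2 := hi.2
        rw [hv.eq_off i (by rintro (h | h) <;> [exact hiK h; (simp at h; omega)]), hui i (by omega)]
        simp [hμ, hiK])
    (fun k hk => by
      rcases k with _ | k
      · simp
      · rw [hsum]
        linarith [hmin (K + (k + 1)) ⟨by omega, by omega⟩])
    (by rw [hsum]; ring)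
  have hwK' : w (K + (n + 1)) = v (K + (n + 1)) := hw.eq_off _ (by simp)
  refine ⟨w, β, (hv.mono ?_).trans (hw.mono Set.Ico_subset_Icc_self), hwd, ?_, ?_, ?_, ?_⟩
  · rintro i (rfl | rfl)
    · exact ⟨le_rfl, by omega⟩
    · exact ⟨by omega, le_rfl⟩
  · rw [hwK', hvK']
    congr 1
    ring
  · rw [hwK']
    refine Submodule.span_le.2 ?_ hβ
    rintro _ rfl
    exact hw.mem_span_image K ⟨le_rfl, by omega⟩
  · have : ‖β‖ ^ 2 * S K ≤ ‖β‖ ^ 2 * (lam (K + (n + 1)) - (lam K - S K)) :=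
      mul_le_mul_of_nonneg_left (by linarith [hlam hK.le]) (sq_nonneg _)
    linarith
  · exact fun h => hβ0 (by linarith)

/-- A vector whose component outside `S` is passed along unit vectors `g j`, with factors controlled
by a null sequence `s`, lies in the closure of `S`. -/
lemma mem_topologicalClosure_of_carrier (S : Submodule ℂ V) {g : ℕ → V} {β : ℕ → ℂ} {s : ℕ → ℝ}
    (hg : ∀ j, ‖g j‖ = 1) (hs : Tendsto s atTop (nhds 0))
    (hgS : ∀ j, g j - β j • g (j + 1) ∈ S) (hβ : ∀ j, ‖β j‖ ^ 2 * s j ≤ s (j + 1))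
    (hβ0 : ∀ j, s (j + 1) = 0 → β j = 0) (hs0 : ∀ j, 0 ≤ s j) {v : V} {J : ℕ} {c : ℂ}
    (hv : v - c • g J ∈ S) : v ∈ S.topologicalClosure := by
  have hnext : ∀ {j} {c : ℂ}, v - c • g j ∈ S → v - (c * β j) • g (j + 1) ∈ S :=
    fun {j c} h => by
      have := S.add_mem h (S.smul_mem c (hgS j))
      rwa [smul_sub, smul_smul, sub_add_sub_cancel] at this
  obtain ⟨C, hC, hstart⟩ : ∃ C : ℝ, 0 ≤ C ∧ ‖c * β J‖ ^ 2 ≤ C * s (J + 1) := by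
    by_cases h : s (J + 1) = 0
    · exact ⟨0, le_rfl, by simp [hβ0 J h]⟩
    · exact ⟨‖c * β J‖ ^ 2 / s (J + 1), div_nonneg (sq_nonneg _) (hs0 _),
        (div_mul_cancel₀ _ h).ge⟩
  have hall : ∀ j ≥ J + 1, ∃ c' : ℂ, v - c' • g j ∈ S ∧ ‖c'‖ ^ 2 ≤ C * s j := fun j hj => by
    induction j, hj using Nat.le_induction with
    | base => exact ⟨_, hnext hv, hstart⟩
    | succ j hj ih =>
      obtain ⟨c', hc', hle⟩ := ih
      refine ⟨_, hnext hc', ?_⟩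
      calc ‖c' * β j‖ ^ 2 = ‖c'‖ ^ 2 * ‖β j‖ ^ 2 := by rw [norm_mul, mul_pow]
        _ ≤ C * s j * ‖β j‖ ^ 2 := mul_le_mul_of_nonneg_right hle (sq_nonneg _)
        _ = C * (‖β j‖ ^ 2 * s j) := by ring
        _ ≤ C * s (j + 1) := mul_le_mul_of_nonneg_left (hβ j) hC
  refine Metric.mem_closure_iff.2 fun ε hε => ?_
  have hlim : Tendsto (fun j => C * s j) atTop (nhds 0) := by simpa using hs.const_mul C
  obtain ⟨j, hjε, hj⟩ :=
    ((hlim.eventually_lt_const (pow_pos hε 2)).and (eventually_ge_atTop (J + 1))).exists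
  obtain ⟨c', hc', hle⟩ := hall j hj
  refine ⟨_, hc', ?_⟩
  rw [dist_eq_norm, sub_sub_cancel, norm_smul, hg, mul_one]
  exact lt_of_pow_lt_pow_left₀ 2 hε.le (hle.trans_lt hjε)

/-- Conservation of mass for a Hermitian form on an inner product space. -/
theorem exists_orthonormal_diagonal (B : V →ₗ⋆[ℂ] V →ₗ[ℂ] ℂ) (hB : ∀ x y, B y x = conj (B x y))
    {d lam : ℕ → ℝ} (hd : Monotone d) (hlam : Monotone lam) (hδ : ∀ k, 0 ≤ excess d lam k)
    (hfreq : ∀ ε > 0, ∀ N, ∃ k > N, excess d lam k < ε)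
    {f : ℕ → V} (hf : Orthonormal ℂ f) (hfd : ∀ i, B (f i) (f i) = lam i) :
    ∃ e : ℕ → V, Orthonormal ℂ e ∧ (∀ k, e k ∈ Submodule.span ℂ (Set.range f)) ∧
      (∀ k, f k ∈ (Submodule.span ℂ (Set.range e)).topologicalClosure) ∧
      ∀ i, B (e i) (e i) = d i := by
  choose next hnext hnmin hnε hnle using fun (K n : ℕ) =>
    exists_block_end hd hlam hδ hfreq K (ε := 1 / ((n : ℝ) + 1)) (by positivity)
  let K : ℕ → ℕ := fun j => Nat.rec 0 (fun j k => next k j) j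
  have hKlt : ∀ j, K j < K (j + 1) := fun j => hnext (K j) j
  have hKmono : StrictMono K := strictMono_nat_of_lt_succ hKlt
  let s : ℕ → ℝ := fun j => excess d lam (K j)
  have hs : Tendsto s atTop (nhds 0) := by
    rw [← tendsto_add_atTop_iff_nat 1]
    exact squeeze_zero (fun j => hδ _) (fun j => hnε (K j) j)
      tendsto_one_div_add_atTop_nhds_zero_nat
  let Inv : ℕ → (ℕ → V) → Prop := fun j u => Orthonormal ℂ u ∧ (∀ i > K j, u i = f i) ∧
    (∀ i < K j, B (u i) (u i) = d i) ∧ B (u (K j)) (u (K j)) = (lam (K j) - s j : ℝ) ∧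
    ∀ i, u i ∈ Submodule.span ℂ (Set.range f)
  let Step : ℕ → (ℕ → V) → (ℕ → V) → ℂ → Prop := fun j u u' β =>
    IsRebasing (Set.Icc (K j) (K (j + 1))) u u' ∧
    u (K j) - β • u' (K (j + 1)) ∈ Submodule.span ℂ (u' '' Set.Ico (K j) (K (j + 1))) ∧
    ‖β‖ ^ 2 * s j ≤ s (j + 1) ∧ (s (j + 1) = 0 → β = 0)
  have hstep : ∀ j u, Inv j u → ∃ u' β, Inv (j + 1) u' ∧ Step j u u' β := by
    rintro j u ⟨hu, huf, hud, huK, hspan⟩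
    obtain ⟨u', β, hR, hdiag, hlast, hβ, hβs, hβ0⟩ := exists_block_step B hB hd hlam hδ (hKlt j)
      (hnmin (K j) j) (hnle (K j) j) hu huK (fun i hi => by rw [huf i hi, hfd])
    refine ⟨u', β, ⟨hR.orthonormal, fun i hi => ?_, fun i hi => ?_, hlast, fun i => ?_⟩,
      hR, hβ, hβs, hβ0⟩
    · rw [hR.eq_off i fun h => h.2.not_gt hi, huf i ((hKlt j).trans hi)]
    · rcases lt_or_ge i (K j) with h | h
      · rw [hR.eq_off i fun h' => h'.1.not_gt h, hud i h]
      · exact hdiag i ⟨h, hi⟩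
    · refine Submodule.span_le.2 ?_ (hR.mem_span i)
      rintro _ ⟨l, rfl⟩
      exact hspan l
  have hinit : Inv 0 f := by
    refine ⟨hf, fun _ _ => rfl, fun i hi => absurd hi (Nat.not_lt_zero i), ?_,
      fun i => Submodule.subset_span ⟨i, rfl⟩⟩
    rw [hfd]
    simp [s, K, excess]
  obtain ⟨U, β, hU0, hInv, hStep⟩ : ∃ (U : ℕ → ℕ → V) (β : ℕ → ℂ), U 0 = f ∧
      (∀ j, Inv j (U j)) ∧ ∀ j, Step j (U j) (U (j + 1)) (β j) := by
    choose next' β hI hS using hstep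
    let U : ∀ j, {u // Inv j u} := fun j =>
      Nat.rec ⟨f, hinit⟩ (fun j u => ⟨next' j u.1 u.2, hI j u.1 u.2⟩) j
    exact ⟨fun j => (U j).1, fun j => β j (U j).1 (U j).2, rfl, fun j => (U j).2,
      fun j => hS j (U j).1 (U j).2⟩
  have hstable : ∀ {j j' i}, j ≤ j' → i < K j → U j' i = U j i := fun {j j' i} hj hi => by
    induction j', hj using Nat.le_induction with
    | base => rfl
    | succ j' hj ih =>
      rw [(hStep j').1.eq_off i fun h => h.1.not_gt (hi.trans_le (hKmono.monotone hj)), ih]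
  let e : ℕ → V := fun i => U (i + 1) i
  have hi : ∀ i, i < K (i + 1) := fun i => hKmono.id_le (i + 1)
  have he : ∀ {i j}, i < K j → e i = U j i := fun {i j} hij => by
    rcases le_total (i + 1) j with h | h
    · exact (hstable h (hi i)).symm
    · exact hstable h hij
  have hUS : ∀ {i j}, i < K j → U j i ∈ Submodule.span ℂ (Set.range e) := fun {i j} hij =>
    Submodule.subset_span ⟨i, he hij⟩
  refine ⟨e, ?_, fun k => (hInv (k + 1)).2.2.2.2 k, fun k => ?_,
    fun i => (hInv (i + 1)).2.2.1 i (hi i)⟩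
  · rw [orthonormal_iff_ite]
    intro i j
    rw [he ((hi i).trans_le (hKmono.monotone (le_max_left (i + 1) (j + 1)))),
      he ((hi j).trans_le (hKmono.monotone (le_max_right (i + 1) (j + 1))))]
    exact orthonormal_iff_ite.1 (hInv _).1 i j
  · have hcarrier : ∀ j, ∀ i ≤ K j,
        f i ∈ Submodule.span ℂ (Set.range e) ⊔ Submodule.span ℂ {U j (K j)} := by
      intro j
      induction j with
      | zero =>
        intro i hi0
        obtain rfl : i = 0 := Nat.le_zero.1 hi0
        rw [hU0]
        exact Submodule.mem_sup_right (Submodule.mem_span_singleton_self _)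
      | succ j ih =>
        intro i hij
        have hblock : ∀ l ∈ Set.Icc (K j) (K (j + 1)), U j l ∈
            Submodule.span ℂ (Set.range e) ⊔ Submodule.span ℂ {U (j + 1) (K (j + 1))} := by
          intro l hl
          refine Submodule.span_le.2 ?_ ((hStep j).1.mem_span_image l hl)
          rintro _ ⟨m, hm, rfl⟩
          rcases hm.2.lt_or_eq with h | rfl
          · exact Submodule.mem_sup_left (hUS h)
          · exact Submodule.mem_sup_right (Submodule.mem_span_singleton_self _)
        rcases le_or_gt i (K j) with h | h
        · suffices hle : Submodule.span ℂ {U j (K j)} ≤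
              Submodule.span ℂ (Set.range e) ⊔ Submodule.span ℂ {U (j + 1) (K (j + 1))} from
            sup_le (α := Submodule ℂ V) le_sup_left hle (ih i h)
          rw [Submodule.span_singleton_le_iff_mem]
          exact hblock _ ⟨le_rfl, (hKlt j).le⟩
        · rw [← (hInv j).2.1 i h]
          exact hblock i ⟨h.le, hij⟩
    obtain ⟨w, hw, z, hz, hwz⟩ := Submodule.mem_sup.1 (hcarrier (k + 1) k (hi k).le)
    obtain ⟨c, rfl⟩ := Submodule.mem_span_singleton.1 hz
    refine mem_topologicalClosure_of_carrier _ (g := fun j => U j (K j)) (β := β) (s := s)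
      (J := k + 1) (c := c) (fun j => (hInv j).1.norm_eq_one _) hs (fun j => ?_)
      (fun j => (hStep j).2.2.1) (fun j => (hStep j).2.2.2) (fun j => hδ _) ?_
    · refine Submodule.span_le.2 ?_ (hStep j).2.1
      rintro _ ⟨m, hm, rfl⟩
      exact hUS hm.2
    · rwa [← hwz, add_sub_cancel_right]

end Rebasing

/-- Conservation of mass theorem: if $\{d_i\}, \{\lambda_i\}$ are nondecreasing with
$\delta_k = \sum_{i<k}(d_i-\lambda_i) \ge 0$ and $\liminf_k \delta_k = 0$, and the
symmetric operator $E$ has diagonal $\{\lambda_i\}$ w.r.t. an orthonormal sequence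
$\{f_i\}$ in its dense domain, then $E$ has diagonal $\{d_i\}$ w.r.t. an orthonormal
sequence $\{e_i\}$ with the same closed span, each $e_k$ in the algebraic span of the
$f_i$.  (No unboundedness of $\{\lambda_i\}$ is assumed.) -/
theorem stmt_10 {H : Type*} [NormedAddCommGroup H] [InnerProductSpace ℂ H] [CompleteSpace H]
    (D : Submodule ℂ H) (hD : Dense (D : Set H)) (E : D →ₗ[ℂ] H)
    (hsym : ∀ f g : D, ⟪E f, (g : H)⟫_ℂ = ⟪(f : H), E g⟫_ℂ)
    (d lam : ℕ → ℝ) (hd : Monotone d) (hlam : Monotone lam)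
    (hδ : ∀ k, 0 ≤ ∑ i ∈ Finset.range k, (d i - lam i))
    (hliminf : liminf (fun k => ((∑ i ∈ Finset.range k, (d i - lam i) : ℝ) : EReal)) atTop = 0)
    (f : ℕ → D) (hf : Orthonormal ℂ fun i => (f i : H))
    (hfd : ∀ i, ⟪(f i : H), E (f i)⟫_ℂ = (lam i : ℂ)) :
    ∃ e : ℕ → D, Orthonormal ℂ (fun i => (e i : H)) ∧
      (∀ k, (e k : H) ∈ Submodule.span ℂ (Set.range fun i => (f i : H))) ∧
      (Submodule.span ℂ (Set.range fun i => (e i : H))).topologicalClosure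
        = (Submodule.span ℂ (Set.range fun i => (f i : H))).topologicalClosure ∧
      ∀ i, ⟪(e i : H), E (e i)⟫_ℂ = (d i : ℂ) := by
  let B : D →ₗ⋆[ℂ] D →ₗ[ℂ] ℂ := LinearMap.mk₂'ₛₗ (starRingEnd ℂ) (RingHom.id ℂ)
    (fun x y => ⟪(x : H), E y⟫_ℂ) (fun x y z => inner_add_left (x : H) y (E z))
    (fun c x y => inner_smul_left (x : H) (E y) c) (fun x y z => by simp)
    (fun c x y => by simp)
  have hB : ∀ x y, B y x = conj (B x y) := fun x y =>
    (hsym y x).symm.trans (inner_conj_symm (E y) (x : H)).symm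
  have hfreq : ∀ ε > 0, ∀ N, ∃ k > N, excess d lam k < ε := fun ε hε N => by
    have hlt : liminf (fun k => ((excess d lam k : ℝ) : EReal)) atTop < (ε : EReal) :=
      hliminf.trans_lt (by exact_mod_cast hε)
    obtain ⟨k, hk, hkN⟩ :=
      ((frequently_lt_of_liminf_lt (h := hlt)).and_eventually (eventually_gt_atTop N)).exists
    exact ⟨k, hkN, by exact_mod_cast hk⟩
  obtain ⟨e, he, hspan, hcl, hdiag⟩ := exists_orthonormal_diagonal B hB hd hlam hδ hfreq
    (f := f) ((D.subtypeₗᵢ.orthonormal_comp_iff).1 hf) hfd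
  have hmap : ∀ g : ℕ → D, Submodule.span ℂ (Set.range fun i => (g i : H)) =
      (Submodule.span ℂ (Set.range g)).map D.subtype := fun g => by
    rw [Submodule.map_span, ← Set.range_comp]
    rfl
  refine ⟨e, (D.subtypeₗᵢ.orthonormal_comp_iff).2 he, fun k => ?_, le_antisymm ?_ ?_, hdiag⟩
  · rw [hmap]
    exact Submodule.mem_map_of_mem (hspan k)
  · refine Submodule.topologicalClosure_mono (Submodule.span_le.2 ?_)
    rintro _ ⟨k, rfl⟩
    rw [hmap]
    exact Submodule.mem_map_of_mem (hspan k)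
  · refine Submodule.topologicalClosure_minimal _ (Submodule.span_le.2 ?_)
      (Submodule.isClosed_topologicalClosure _)
    rintro _ ⟨k, rfl⟩
    rw [hmap]
    exact map_mem_closure continuous_subtype_val (hcl k) fun x hx => Submodule.mem_map_of_mem hx
end

section
/- Let $E$ be a symmetric operator on a dense domain $\mathcal{D}$, and let $\{d_i\}$, $\{\lambda_i\}$ be nondecreasing unbounded real sequences satisfying $\sum_{i=1}^n \lambda_i \le \sum_{i=1}^n d_i$ for all $n$. If there exists an orthonormal sequence $\{f_i\}_{i\in\mathbb{N}} \subset \mathcal{D}$ with $\langle Ef_i, f_i\rangle = \lambda_i$ for all $i$, then there exists an orthonormal sequence $\{e_i\}_{i\in\mathbb{N}}$ contained in the algebraic linear span of $\{f_i\}$, with the same closed linear span as $\{f_i\}$, such that $\langle Ee_i, e_i\rangle = d_i$ for all $i$. -/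
open scoped InnerProductSpace

section DiagonalToDiagonal

variable {V : Type*} [NormedAddCommGroup V] [InnerProductSpace ℂ V]

/-- `Q` loses its cross term on every pair of vectors, after multiplying the second one by a
suitable phase. Quadratic forms of symmetric operators have this property. -/
def DecouplesPairs (Q : V → ℝ) : Prop :=
  ∀ u w : V, ∃ ζ : ℂ, ‖ζ‖ = 1 ∧
    ∀ c s : ℝ, Q ((c : ℂ) • u + ((s : ℂ) * ζ) • w) = c ^ 2 * Q u + s ^ 2 * Q w

lemma exists_phase_re_mul_eq_zero (z : ℂ) : ∃ ζ : ℂ, ‖ζ‖ = 1 ∧ (ζ * z).re = 0 := by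
  by_cases hz : z = 0
  · exact ⟨1, by simp, by simp [hz]⟩
  · have hn : (‖z‖ : ℂ) ≠ 0 := by simpa using hz
    refine ⟨Complex.I * (starRingEnd ℂ z) / ‖z‖, ?_, ?_⟩
    · simp [hz]
    · have h : Complex.I * (starRingEnd ℂ z) / ‖z‖ * z = Complex.I * ‖z‖ := by
        field_simp
        rw [mul_comm, Complex.mul_conj']
      rw [h]
      simp

lemma decouplesPairs_of_symmetric {H : Type*} [NormedAddCommGroup H] [InnerProductSpace ℂ H]
    {D : Submodule ℂ H} {E : D →ₗ[ℂ] H}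
    (hsym : ∀ f g : D, ⟪E f, (g : H)⟫_ℂ = ⟪(f : H), E g⟫_ℂ) :
    DecouplesPairs fun x : D => (⟪(x : H), E x⟫_ℂ).re := by
  intro u w
  obtain ⟨ζ, hζ, hre⟩ := exists_phase_re_mul_eq_zero ⟪(u : H), E w⟫_ℂ
  refine ⟨ζ, hζ, fun c s => ?_⟩
  have hwu : ⟪(w : H), E u⟫_ℂ = starRingEnd ℂ ⟪(u : H), E w⟫_ℂ := by
    rw [← hsym, inner_conj_symm]
  have hζ' : ζ.re ^ 2 + ζ.im ^ 2 = 1 := by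
    have := Complex.sq_norm ζ
    rw [hζ, Complex.normSq_apply] at this
    linarith
  simp only [map_add, map_smul, Submodule.coe_add, Submodule.coe_smul, inner_add_left,
    inner_add_right, inner_smul_left, inner_smul_right, hwu]
  generalize ⟪(u : H), E w⟫_ℂ = z at hre
  simp only [Complex.add_re, Complex.add_im, Complex.mul_re, Complex.mul_im, Complex.conj_re,
    Complex.conj_im, Complex.ofReal_re, Complex.ofReal_im, map_mul] at hre ⊢
  linear_combination (2 * c * s) * hre + s ^ 2 * (⟪(w : H), E w⟫_ℂ).re * hζ'

lemma sum_range_transfer {a b : ℕ → ℝ} {p q : ℕ} (hpq : p < q) {ε : ℝ}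
    (hp : b p = a p + ε) (hq : b q = a q - ε) (h : ∀ i, i ≠ p → i ≠ q → b i = a i) (n : ℕ) :
    ∑ i ∈ Finset.range n, b i
      = ∑ i ∈ Finset.range n, a i + if p < n ∧ n ≤ q then ε else 0 := by
  induction n with
  | zero => simp
  | succ n ih =>
    rw [Finset.sum_range_succ, Finset.sum_range_succ, ih]
    rcases eq_or_ne n p with rfl | hnp
    · rw [hp, if_neg (by omega), if_pos (by omega)]; ring
    rcases eq_or_ne n q with rfl | hnq
    · rw [hq, if_pos (by omega), if_neg (by omega)]; ring
    rw [h n hnp hnq]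
    by_cases hc : p < n ∧ n ≤ q
    · rw [if_pos hc, if_pos (by omega)]; ring
    · rw [if_neg hc, if_neg (by omega)]; ring

/-- Replacing two members of an orthonormal sequence by an orthonormal pair in their span keeps the
sequence orthonormal. -/
lemma Orthonormal.update_pair {v : ℕ → V} (hv : Orthonormal ℂ v) {p q : ℕ} (hpq : p ≠ q)
    {x y : V} (hx : ‖x‖ = 1) (hy : ‖y‖ = 1) (hxy : ⟪x, y⟫_ℂ = 0)
    (hxs : x ∈ Submodule.span ℂ {v p, v q}) (hys : y ∈ Submodule.span ℂ {v p, v q}) :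
    Orthonormal ℂ (Function.update (Function.update v p x) q y) := by
  have horth : ∀ z ∈ Submodule.span ℂ {v p, v q}, ∀ i, i ≠ p → i ≠ q → ⟪z, v i⟫_ℂ = 0 := by
    intro z hz i hip hiq
    obtain ⟨a, b, rfl⟩ := Submodule.mem_span_pair.1 hz
    simp [hv.2 hip.symm, hv.2 hiq.symm]
  have hxv := horth x hxs
  have hyv := horth y hys
  refine ⟨fun i => ?_, fun i j hij => ?_⟩
  · rcases eq_or_ne i q with rfl | hiq
    · simpa using hy
    rcases eq_or_ne i p with rfl | hip
    · simpa [hiq] using hx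
    simpa [hiq, hip] using hv.1 i
  · change ⟪_, _⟫_ℂ = 0
    rcases eq_or_ne i q with rfl | hiq
    · rcases eq_or_ne j p with rfl | hjp
      · simpa [hpq] using inner_eq_zero_symm.1 hxy
      · simpa [hij.symm, hjp] using hyv j hjp hij.symm
    rcases eq_or_ne i p with rfl | hip
    · rcases eq_or_ne j q with rfl | hjq
      · simpa [hpq] using hxy
      · simpa [hpq, hjq, hij.symm] using hxv j hij.symm hjq
    rcases eq_or_ne j q with rfl | hjq
    · simpa [hiq, hip] using inner_eq_zero_symm.1 (hyv i hip hiq)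
    rcases eq_or_ne j p with rfl | hjp
    · simpa [hiq, hip, hjq] using inner_eq_zero_symm.1 (hxv i hip hiq)
    simpa [hiq, hip, hjq, hjp] using hv.2 hij

/-- A rotation of two members of an orthonormal sequence moving an amount `ε` of `Q` from the
later to the earlier one. -/
lemma exists_rotation_s14 {Q : V → ℝ} (hQ : DecouplesPairs Q) {v : ℕ → V} (hv : Orthonormal ℂ v)
    {p q : ℕ} (hpq : p < q) {ε : ℝ} (h0 : 0 ≤ ε) (h1 : ε ≤ Q (v q) - Q (v p)) :
    ∃ v' : ℕ → V, Orthonormal ℂ v' ∧ (∀ i, i ≠ p → i ≠ q → v' i = v i) ∧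
      (∀ n, ∑ i ∈ Finset.range n, Q (v' i)
        = ∑ i ∈ Finset.range n, Q (v i) + if p < n ∧ n ≤ q then ε else 0) ∧
      Q (v' p) = Q (v p) + ε ∧
      (∀ i, v' i ∈ Submodule.span ℂ (Set.range v)) ∧
      ∃ a b a' b' : ℂ, v p = a • v' p + b • v' q ∧ v q = a' • v' p + b' • v' q ∧
        ‖b‖ ^ 2 * (Q (v q) - Q (v p)) = ε ∧ ‖b'‖ ≤ 1 := by
  obtain ⟨c, s, hcs, hs⟩ : ∃ c s : ℝ, c ^ 2 + s ^ 2 = 1 ∧ s ^ 2 * (Q (v q) - Q (v p)) = ε := by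
    have hr0 : 0 ≤ ε / (Q (v q) - Q (v p)) := div_nonneg h0 (h0.trans h1)
    have hr1 : ε / (Q (v q) - Q (v p)) ≤ 1 := div_le_one_of_le₀ h1 (h0.trans h1)
    refine ⟨√(1 - ε / (Q (v q) - Q (v p))), √(ε / (Q (v q) - Q (v p))), ?_, ?_⟩
    · rw [Real.sq_sqrt (by linarith), Real.sq_sqrt hr0]; ring
    · rw [Real.sq_sqrt hr0]
      by_cases hz : Q (v q) - Q (v p) = 0
      · rw [hz] at h1 ⊢; linarith
      · field_simp
  obtain ⟨ζ, hζ, hQζ⟩ := hQ (v p) (v q)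
  have hcs' : (c : ℂ) ^ 2 + (s : ℂ) ^ 2 = 1 := by exact_mod_cast hcs
  have hζζ : starRingEnd ℂ ζ * ζ = 1 := by rw [Complex.conj_mul', hζ]; simp
  have hpp : ⟪v p, v p⟫_ℂ = 1 := by simp [inner_self_eq_norm_sq_to_K, hv.1 p]
  have hqq : ⟪v q, v q⟫_ℂ = 1 := by simp [inner_self_eq_norm_sq_to_K, hv.1 q]
  have hpq0 : ⟪v p, v q⟫_ℂ = 0 := hv.2 hpq.ne
  have hqp0 : ⟪v q, v p⟫_ℂ = 0 := hv.2 hpq.ne'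
  have hin : ∀ c₁ s₁ c₂ s₂ : ℝ, ⟪(c₁ : ℂ) • v p + ((s₁ : ℂ) * ζ) • v q,
      (c₂ : ℂ) • v p + ((s₂ : ℂ) * ζ) • v q⟫_ℂ = c₁ * c₂ + s₁ * s₂ := by
    intro c₁ s₁ c₂ s₂
    simp only [inner_add_left, inner_add_right, inner_smul_left, inner_smul_right, hpp, hqq, hpq0,
      hqp0, map_mul, Complex.conj_ofReal]
    linear_combination (s₁ * s₂ : ℂ) * hζζ
  have hnorm : ∀ c₁ s₁ : ℝ, c₁ ^ 2 + s₁ ^ 2 = 1 →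
      ‖(c₁ : ℂ) • v p + ((s₁ : ℂ) * ζ) • v q‖ = 1 := by
    intro c₁ s₁ h
    have h2 := hin c₁ s₁ c₁ s₁
    rw [inner_self_eq_norm_sq_to_K] at h2
    have h3 : ‖(c₁ : ℂ) • v p + ((s₁ : ℂ) * ζ) • v q‖ ^ 2 = 1 := by
      rw [← h, sq c₁, sq s₁]
      exact Complex.ofReal_injective (by push_cast; exact h2)
    exact (pow_eq_one_iff_of_nonneg (norm_nonneg _) two_ne_zero).1 h3
  set x : V := (c : ℂ) • v p + ((s : ℂ) * ζ) • v q with hx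
  set y : V := (s : ℂ) • v p + (((-c : ℝ) : ℂ) * ζ) • v q with hy
  have hxs : x ∈ Submodule.span ℂ {v p, v q} := Submodule.mem_span_pair.2 ⟨_, _, rfl⟩
  have hys : y ∈ Submodule.span ℂ {v p, v q} := Submodule.mem_span_pair.2 ⟨_, _, rfl⟩
  have hsub : Submodule.span ℂ {v p, v q} ≤ Submodule.span ℂ (Set.range v) :=
    Submodule.span_mono (by rintro _ (rfl | rfl) <;> exact ⟨_, rfl⟩)
  have hQx : Q x = Q (v p) + ε := by
    rw [hx, hQζ]; linear_combination Q (v p) * hcs + hs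
  have hQy : Q y = Q (v q) - ε := by
    rw [hy, hQζ]; linear_combination Q (v q) * hcs - hs
  have hother : ∀ i, i ≠ p → i ≠ q →
      Function.update (Function.update v p x) q y i = v i := by
    intro i hip hiq; simp [hip, hiq]
  have hup : Function.update (Function.update v p x) q y p = x := by simp [hpq.ne]
  have huq : Function.update (Function.update v p x) q y q = y := by simp
  refine ⟨Function.update (Function.update v p x) q y,
    hv.update_pair hpq.ne (hnorm c s hcs) (hnorm s (-c) (by rw [← hcs]; ring)) ?_ hxs hys,
    hother, ?_, ?_, ?_, c, s, starRingEnd ℂ ζ * s, -(starRingEnd ℂ ζ * c), ?_, ?_, ?_, ?_⟩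
  · rw [hx, hy, hin]; push_cast; ring
  · refine sum_range_transfer (a := fun i => Q (v i)) hpq ?_ ?_ fun i hip hiq => ?_
    · simp only [hup, hQx]
    · simp only [huq, hQy]
    · simp only [hother i hip hiq]
  · rw [hup, hQx]
  · intro i
    rcases eq_or_ne i q with rfl | hiq
    · rw [huq]; exact hsub hys
    rcases eq_or_ne i p with rfl | hip
    · rw [hup]; exact hsub hxs
    rw [hother i hip hiq]
    exact Submodule.subset_span ⟨i, rfl⟩
  · rw [hup, huq, hx, hy]
    push_cast
    match_scalars
    · linear_combination -hcs'
    · ring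
  · rw [hup, huq, hx, hy]
    push_cast
    match_scalars
    · linear_combination -hcs' * (starRingEnd ℂ ζ * ζ) - hζζ
    · ring
  · simpa using hs
  · have : |c| ≤ 1 := by rw [← sq_le_one_iff_abs_le_one]; nlinarith [sq_nonneg s]
    simpa [hζ] using this

/-- Finite Schur–Horn step, performed in place on the entries `k, …, m - 1`. -/
lemma exists_diagonal_of_sum_eq {Q : V → ℝ} (hQ : DecouplesPairs Q) {d : ℕ → ℝ} (hd : Monotone d)
    {k m : ℕ} (hkm : k ≤ m) {v : ℕ → V} (hv : Orthonormal ℂ v) (hk : ∀ i < k, Q (v i) = d i)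
    (hle : ∀ n, ∑ i ∈ Finset.range n, Q (v i) ≤ ∑ i ∈ Finset.range n, d i)
    (heq : ∑ i ∈ Finset.range m, Q (v i) = ∑ i ∈ Finset.range m, d i) :
    ∃ v' : ℕ → V, Orthonormal ℂ v' ∧ (∀ i < k, v' i = v i) ∧ (∀ i, m ≤ i → v' i = v i) ∧
      (∀ i < m, Q (v' i) = d i) ∧
      (∀ n, ∑ i ∈ Finset.range n, Q (v' i) ≤ ∑ i ∈ Finset.range n, d i) ∧
      (∀ i, v' i ∈ Submodule.span ℂ (Set.range v)) ∧
      ∀ i < m, v i ∈ Submodule.span ℂ (v' '' Set.Iio m) := by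
  induction hkm using Nat.decreasingInduction generalizing v with
  | self =>
    exact ⟨v, hv, fun _ _ => rfl, fun _ _ => rfl, hk, hle,
      fun i => Submodule.subset_span ⟨i, rfl⟩, fun i hi => Submodule.subset_span ⟨i, hi, rfl⟩⟩
  | of_succ k hkm ih =>
    have hsumk : ∑ i ∈ Finset.range k, Q (v i) = ∑ i ∈ Finset.range k, d i :=
      Finset.sum_congr rfl fun i hi => hk i (Finset.mem_range.1 hi)
    have hvk : Q (v k) ≤ d k := by
      have := hle (k + 1)
      rw [Finset.sum_range_succ, Finset.sum_range_succ, hsumk] at this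
      linarith
    rcases hvk.eq_or_lt with hvk | hvk
    · obtain ⟨v', h1, h2, h3⟩ := ih hv
        (fun i hi => (Nat.lt_succ_iff_lt_or_eq.1 hi).elim (hk i) fun h => h ▸ hvk) hle heq
      exact ⟨v', h1, fun i hi => h2 i (by omega), h3⟩
    have hex : ∃ j, k < j ∧ j < m ∧ d k ≤ Q (v j) := by
      by_contra! hcon
      have hlt : ∑ i ∈ Finset.range m, Q (v i) < ∑ i ∈ Finset.range m, d i := by
        refine Finset.sum_lt_sum (fun i hi => ?_) ⟨k, Finset.mem_range.2 hkm, hvk⟩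
        rcases lt_trichotomy i k with h | rfl | h
        · exact (hk i h).le
        · exact hvk.le
        · exact (hcon i h (Finset.mem_range.1 hi)).le.trans (hd h.le)
      exact hlt.ne heq
    classical
    obtain ⟨hkj, hjm, hdj⟩ := Nat.find_spec hex
    have hmin : ∀ i, k < i → i < Nat.find hex → Q (v i) < d k := fun i hki hij => by
      have := Nat.find_min hex hij
      push Not at this
      exact this hki (hij.trans hjm)
    generalize Nat.find hex = j at hkj hjm hdj hmin
    obtain ⟨v₁, ho, hother, hsum, hQk, hmem, a, b, a', b', hp, hq, -, -⟩ :=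
      exists_rotation_s14 hQ hv hkj (ε := d k - Q (v k)) (by linarith) (by linarith)
    have hpart : ∀ n, k < n → n ≤ j →
        ∑ i ∈ Finset.range n, Q (v i) + (d k - Q (v k)) ≤ ∑ i ∈ Finset.range n, d i := by
      intro n hkn
      induction n, hkn using Nat.le_induction with
      | base =>
        intro _
        rw [Finset.sum_range_succ, Finset.sum_range_succ, hsumk]
        linarith
      | succ n hn ihn =>
        intro hnj
        rw [Finset.sum_range_succ, Finset.sum_range_succ]
        have := ihn (by omega)
        have := hmin n hn (by omega)
        have := hd (show k ≤ n by omega)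
        linarith
    obtain ⟨v', h1, h2, h3, h4, h5, h6, h7⟩ := ih ho
      (by
        intro i hi
        rcases Nat.lt_succ_iff_lt_or_eq.1 hi with h | rfl
        · rw [hother i (by omega) (by omega), hk i h]
        · rw [hQk]; ring)
      (by
        intro n
        rw [hsum]
        split_ifs with hn
        · exact hpart n hn.1 hn.2
        · simpa using hle n)
      (by rw [hsum, if_neg (by omega), heq, add_zero])
    refine ⟨v', h1, fun i hi => ?_, fun i hi => ?_, h4, h5, fun i => ?_, fun i hi => ?_⟩
    · rw [h2 i (by omega), hother i (by omega) (by omega)]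
    · rw [h3 i hi, hother i (by omega) (by omega)]
    · refine Submodule.span_le.2 ?_ (h6 i)
      rintro _ ⟨l, rfl⟩
      exact hmem l
    · rcases eq_or_ne i k with rfl | hik
      · rw [hp]
        exact add_mem (Submodule.smul_mem _ _ (h7 _ hkm)) (Submodule.smul_mem _ _ (h7 _ hjm))
      rcases eq_or_ne i j with rfl | hij
      · rw [hq]
        exact add_mem (Submodule.smul_mem _ _ (h7 _ hkm)) (Submodule.smul_mem _ _ (h7 _ hjm))
      rw [← hother i hik hij]
      exact h7 i hi

/-- The orthonormal sequence `v` has its first `k` diagonal entries prescribed by `d`, and still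
satisfies the hypotheses needed to prescribe the remaining ones. -/
structure PrescribedBelow (Q : V → ℝ) (d : ℕ → ℝ) (k : ℕ) (v : ℕ → V) : Prop where
  orthonormal : Orthonormal ℂ v
  diag : ∀ i < k, Q (v i) = d i
  sum_le : ∀ n, ∑ i ∈ Finset.range n, Q (v i) ≤ ∑ i ∈ Finset.range n, d i
  tendsto : Filter.Tendsto (fun i => Q (v i)) Filter.atTop Filter.atTop

/-- One can prescribe further diagonal entries so that the entry `v k` is absorbed up to a remainder
of norm at most `1 / 2`, and every later entry only leaves a remainder in its own place. -/
lemma PrescribedBelow.exists_extension {Q : V → ℝ} (hQ : DecouplesPairs Q) {d : ℕ → ℝ}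
    (hd : Monotone d) {k : ℕ} {v : ℕ → V} (h : PrescribedBelow Q d k v) :
    ∃ (m : ℕ) (v' : ℕ → V), PrescribedBelow Q d m v' ∧ k < m ∧ (∀ i < k, v' i = v i) ∧
      (∀ i, v' i ∈ Submodule.span ℂ (Set.range v)) ∧
      (∃ w ∈ Submodule.span ℂ (v' '' Set.Iio m), ∃ (l : ℕ) (b : ℂ),
        ‖b‖ ≤ 1 / 2 ∧ v k = w + b • v' l) ∧
      ∀ i, k < i → ∃ w ∈ Submodule.span ℂ (v' '' Set.Iio m), ∃ b : ℂ,
        ‖b‖ ≤ 1 ∧ v i = w + b • v' i := by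
  set δ : ℕ → ℝ := fun n => ∑ i ∈ Finset.range n, d i - ∑ i ∈ Finset.range n, Q (v i) with hδ
  have hδ0 : ∀ n, 0 ≤ δ n := fun n => sub_nonneg.2 (h.sum_le n)
  obtain ⟨j, hjQ, hkj⟩ := ((h.tendsto.eventually_ge_atTop (Q (v k) + 4 * δ (k + 1) + 1)).and
    (Filter.eventually_gt_atTop k)).exists
  obtain ⟨m, hm, hmin⟩ := Finset.exists_min_image (Finset.Ioc k j) δ ⟨j, by simp [hkj]⟩
  obtain ⟨hkm, hmj⟩ := Finset.mem_Ioc.1 hm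
  have hmk : δ m ≤ δ (k + 1) := hmin _ (Finset.mem_Ioc.2 ⟨by omega, hkj⟩)
  have hδm := hδ0 m
  obtain ⟨v₁, ho, hother, hsum, -, hmem, a, b, a', b', hp, hq, hb, hb'⟩ :=
    exists_rotation_s14 hQ h.orthonormal hkj (ε := δ m) hδm (by linarith)
  obtain ⟨v', h1, h2, h3, h4, h5, h6, h7⟩ := exists_diagonal_of_sum_eq hQ hd hkm.le ho
    (fun i hi => by rw [hother i (by omega) (by omega), h.diag i hi])
    (by
      intro n
      rw [hsum]
      split_ifs with hn
      · have := hmin n (Finset.mem_Ioc.2 hn)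
        simp only [hδ] at this ⊢
        linarith
      · simpa using h.sum_le n)
    (by rw [hsum, if_pos ⟨hkm, hmj⟩]; simp only [hδ]; ring)
  refine ⟨m, v', ⟨h1, h4, h5, ?_⟩, hkm, fun i hi => ?_, fun i => ?_, ?_, fun i hi => ?_⟩
  · refine h.tendsto.congr' ?_
    filter_upwards [Filter.eventually_gt_atTop j] with i hi
    rw [h3 i (by omega), hother i (by omega) (by omega)]
  · rw [h2 i hi, hother i (by omega) (by omega)]
  · refine Submodule.span_le.2 ?_ (h6 i)
    rintro _ ⟨l, rfl⟩
    exact hmem l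
  · refine ⟨a • v₁ k, Submodule.smul_mem _ _ (h7 k hkm), j, b, ?_, by rw [h3 j hmj, hp]⟩
    have hsq : ‖b‖ ^ 2 ≤ (1 / 2) ^ 2 := by nlinarith
    exact le_of_sq_le_sq hsq (by norm_num)
  · rcases eq_or_ne i j with rfl | hij
    · exact ⟨a' • v₁ k, Submodule.smul_mem _ _ (h7 k hkm), b', hb', by rw [h3 i hmj, hq]⟩
    have hvi := hother i hi.ne' hij
    rcases lt_or_ge i m with him | him
    · exact ⟨v i, hvi ▸ h7 i him, 0, by simp, by simp⟩
    · exact ⟨0, zero_mem _, 1, by simp, by simp [h3 i him, hvi]⟩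

/-- Iterating the extension step yields the whole diagonal `d`, on an orthonormal sequence whose
closed span contains the original one. -/
theorem exists_orthonormal_diagonal_s14 {Q : V → ℝ} (hQ : DecouplesPairs Q) {d : ℕ → ℝ}
    (hd : Monotone d) {f : ℕ → V} (hf : PrescribedBelow Q d 0 f) :
    ∃ e : ℕ → V, Orthonormal ℂ e ∧ (∀ i, Q (e i) = d i) ∧
      (∀ i, e i ∈ Submodule.span ℂ (Set.range f)) ∧
      ∀ i, f i ∈ (Submodule.span ℂ (Set.range e)).topologicalClosure := by
  choose! m next hnext using
    fun (k : ℕ) (v : ℕ → V) (h : PrescribedBelow Q d k v) => h.exists_extension hQ hd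
  let st : ℕ → ℕ × (ℕ → V) := fun t => Nat.rec (0, f) (fun _ s => (m s.1 s.2, next s.1 s.2)) t
  let K : ℕ → ℕ := fun t => (st t).1
  let v : ℕ → ℕ → V := fun t => (st t).2
  have hP : ∀ t, PrescribedBelow Q d (K t) (v t) := by
    intro t
    induction t with
    | zero => exact hf
    | succ t ih => exact (hnext _ _ ih).1
  have hK : StrictMono K := strictMono_nat_of_lt_succ fun t => (hnext _ _ (hP t)).2.1
  have hKge : ∀ t, t ≤ K t := hK.id_le
  have hstay : ∀ t, ∀ i < K t, v (t + 1) i = v t i := fun t => (hnext _ _ (hP t)).2.2.1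
  have hstay' : ∀ s t, s ≤ t → ∀ i < K s, v t i = v s i := by
    intro s t hst i hi
    induction t, hst using Nat.le_induction with
    | base => rfl
    | succ t hst ih => rw [hstay t i (hi.trans_le (hK.monotone hst)), ih]
  have hspan : ∀ t i, v t i ∈ Submodule.span ℂ (Set.range f) := by
    intro t
    induction t with
    | zero => exact fun i => Submodule.subset_span ⟨i, rfl⟩
    | succ t ih =>
      intro i
      refine Submodule.span_le.2 ?_ ((hnext _ _ (hP t)).2.2.2.1 i)
      rintro _ ⟨l, rfl⟩
      exact ih l
  let e : ℕ → V := fun i => v (i + 1) i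
  have he : ∀ t i, i < K t → v t i = e i := by
    intro t i hi
    rcases le_total t (i + 1) with hle | hle
    · exact (hstay' t (i + 1) hle i hi).symm
    · exact hstay' (i + 1) t hle i (hKge (i + 1))
  have hespan : ∀ t, Submodule.span ℂ (v t '' Set.Iio (K t)) ≤ Submodule.span ℂ (Set.range e) := by
    intro t
    refine Submodule.span_mono ?_
    rintro _ ⟨i, hi, rfl⟩
    exact ⟨i, (he t i hi).symm⟩
  have happrox : ∀ n N t i, i - K t ≤ N →
      ∃ w ∈ Submodule.span ℂ (Set.range e), ‖v t i - w‖ ≤ (1 / 2 : ℝ) ^ n := by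
    intro n
    induction n with
    | zero => exact fun N t i _ => ⟨0, zero_mem _, by simp [(hP t).orthonormal.1 i]⟩
    | succ n ihn =>
      intro N
      induction N with
      | zero =>
        intro t i hi
        rcases (Nat.sub_eq_zero_iff_le.1 (Nat.le_zero.1 hi)).lt_or_eq with hlt | rfl
        · exact ⟨v t i, he t i hlt ▸ Submodule.subset_span ⟨i, rfl⟩, by simp⟩
        · obtain ⟨w, hw, l, b, hb, hvk⟩ := (hnext _ _ (hP t)).2.2.2.2.1
          obtain ⟨w', hw', hn⟩ := ihn (l - K (t + 1)) (t + 1) l le_rfl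
          refine ⟨w + b • w', add_mem (hespan (t + 1) hw) (Submodule.smul_mem _ _ hw'), ?_⟩
          have hsub : v t (K t) - (w + b • w') = b • (v (t + 1) l - w') := by
            rw [smul_sub, show v t (K t) = w + b • v (t + 1) l from hvk]; abel
          rw [hsub, norm_smul, pow_succ']
          exact mul_le_mul hb hn (norm_nonneg _) (by norm_num)
      | succ N ihN =>
        intro t i hi
        rcases le_or_gt (i - K t) N with hle | hgt
        · exact ihN t i hle
        · obtain ⟨w, hw, b, hb, hvi⟩ := (hnext _ _ (hP t)).2.2.2.2.2 i (show K t < i by omega)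
          have hKt := hK (Nat.lt_succ_self t)
          obtain ⟨w', hw', hn⟩ := ihN (t + 1) i (by simp only [Nat.succ_eq_add_one] at hKt; omega)
          refine ⟨w + b • w', add_mem (hespan (t + 1) hw) (Submodule.smul_mem _ _ hw'), ?_⟩
          have hsub : v t i - (w + b • w') = b • (v (t + 1) i - w') := by
            rw [smul_sub, show v t i = w + b • v (t + 1) i from hvi]; abel
          rw [hsub, norm_smul]
          exact (mul_le_of_le_one_left (norm_nonneg _) hb).trans hn
  refine ⟨e, ⟨fun i => (hP (i + 1)).orthonormal.1 i, fun i j hij => ?_⟩,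
    fun i => (hP (i + 1)).diag i (hKge (i + 1)), fun i => hspan (i + 1) i, fun i => ?_⟩
  · have hge := hKge (i + j + 1)
    change ⟪e i, e j⟫_ℂ = 0
    rw [← he (i + j + 1) i (by omega), ← he (i + j + 1) j (by omega)]
    exact (hP (i + j + 1)).orthonormal.2 hij
  · refine Metric.mem_closure_iff.2 fun ε hε => ?_
    obtain ⟨n, hn⟩ := exists_pow_lt_of_lt_one hε (show (1 / 2 : ℝ) < 1 by norm_num)
    obtain ⟨w, hw, hle⟩ := happrox n _ 0 i le_rfl
    exact ⟨w, hw, by rw [dist_eq_norm]; exact hle.trans_lt hn⟩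

end DiagonalToDiagonal

/-- Main "diagonal to diagonal" theorem: $\{d_i\}, \{\lambda_i\}$ nondecreasing
unbounded with $\sum_{i<n}\lambda_i \le \sum_{i<n} d_i$ for all $n$.  If the symmetric
operator $E$ on a dense domain has diagonal $\{\lambda_i\}$ w.r.t. an orthonormal
sequence $\{f_i\}$, then $E$ has diagonal $\{d_i\}$ w.r.t. an orthonormal sequence
$\{e_i\}$ contained in the algebraic linear span of the $f_i$, with the same closed
linear span. -/
theorem stmt_14 {H : Type*} [NormedAddCommGroup H] [InnerProductSpace ℂ H] [CompleteSpace H]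
    (D : Submodule ℂ H) (hD : Dense (D : Set H)) (E : D →ₗ[ℂ] H)
    (hsym : ∀ f g : D, ⟪E f, (g : H)⟫_ℂ = ⟪(f : H), E g⟫_ℂ)
    (d lam : ℕ → ℝ) (hd : Monotone d) (hlam : Monotone lam)
    (hdub : ¬ BddAbove (Set.range d)) (hlamub : ¬ BddAbove (Set.range lam))
    (hmaj : ∀ n, ∑ i ∈ Finset.range n, lam i ≤ ∑ i ∈ Finset.range n, d i)
    (f : ℕ → D) (hf : Orthonormal ℂ fun i => (f i : H))
    (hfd : ∀ i, ⟪(f i : H), E (f i)⟫_ℂ = (lam i : ℂ)) :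
    ∃ e : ℕ → D, Orthonormal ℂ (fun i => (e i : H)) ∧
      (∀ k, (e k : H) ∈ Submodule.span ℂ (Set.range fun i => (f i : H))) ∧
      (Submodule.span ℂ (Set.range fun i => (e i : H))).topologicalClosure
        = (Submodule.span ℂ (Set.range fun i => (f i : H))).topologicalClosure ∧
      ∀ i, ⟪(e i : H), E (e i)⟫_ℂ = (d i : ℂ) := by
  set Q : D → ℝ := fun x => (⟪(x : H), E x⟫_ℂ).re with hQdef
  have hQ : DecouplesPairs Q := decouplesPairs_of_symmetric hsym
  have hQf : ∀ i, Q (f i) = lam i := fun i => by simp [hQdef, hfd i]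
  have hspan : ∀ g : ℕ → D, Submodule.span ℂ (Set.range fun i => (g i : H))
      = (Submodule.span ℂ (Set.range g)).map D.subtype := by
    intro g
    rw [Submodule.map_span, ← Set.range_comp]
    rfl
  have hlam_tendsto : Filter.Tendsto lam Filter.atTop Filter.atTop :=
    (tendsto_atTop_of_monotone hlam).resolve_right fun ⟨l, hl⟩ => hlamub hl.bddAbove_range
  obtain ⟨e, he, hed, hef, hfe⟩ := exists_orthonormal_diagonal_s14 hQ hd (f := f)
    ⟨⟨hf.1, hf.2⟩, by simp, by simpa only [hQf] using hmaj, by simpa only [hQf] using hlam_tendsto⟩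
  have hmem : ∀ k, (e k : H) ∈ Submodule.span ℂ (Set.range fun i => (f i : H)) := by
    intro k
    rw [hspan]
    exact Submodule.mem_map_of_mem (hef k)
  refine ⟨e, ⟨he.1, he.2⟩, hmem, le_antisymm ?_ ?_, fun i => ?_⟩
  · refine Submodule.topologicalClosure_mono (Submodule.span_le.2 ?_)
    rintro _ ⟨k, rfl⟩
    exact hmem k
  · refine Submodule.topologicalClosure_minimal _ (Submodule.span_le.2 ?_)
      (Submodule.isClosed_topologicalClosure _)
    rintro _ ⟨k, rfl⟩
    rw [hspan]
    exact image_closure_subset_closure_image continuous_subtype_val ⟨f k, hfe k, rfl⟩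
  · have him : (⟪(e i : H), E (e i)⟫_ℂ).im = 0 := by
      rw [← Complex.conj_eq_iff_im, inner_conj_symm, hsym]
    exact Complex.ext (hed i) him
end

section
/- Let $E = \mathrm{diag}\,\boldsymbol{\lambda}$ be a self-adjoint operator on a separable Hilbert space with orthonormal eigenbasis $\{v_i\}$ and nondecreasing unbounded eigenvalue sequence $\{\lambda_i\}$. If $\{d_i\}$ is a nondecreasing unbounded real sequence with $\sum_{i=1}^n \lambda_i \le \sum_{i=1}^n d_i$ for all $n$, then there exists an orthonormal basis $\{e_i\}$ of the Hilbert space, with each $e_i$ a finite linear combination of the $v_j$, such that $\langle E e_i, e_i\rangle = d_i$ for all $i$. -/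
open scoped InnerProductSpace

namespace SchurHorn

variable {H : Type*} [NormedAddCommGroup H] [InnerProductSpace ℂ H]

/-- Rotate the vectors `u p` and `u q` in the plane they span, leaving the others fixed. -/
def planeRotation (u : ℕ → H) (p q : ℕ) (c s : ℝ) (i : ℕ) : H :=
  if i = p then (c : ℂ) • u p + (s : ℂ) • u q
  else if i = q then (-s : ℂ) • u p + (c : ℂ) • u q
  else u i

/-- Move the amount `t` from the `q`-th entry to the `p`-th entry. -/
def transfer (μ : ℕ → ℝ) (p q : ℕ) (t : ℝ) (i : ℕ) : ℝ :=
  μ i + (if i = p then t else 0) - (if i = q then t else 0)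

section planeRotation

variable (u : ℕ → H) {p q : ℕ} (c s : ℝ)

lemma planeRotation_left :
    planeRotation u p q c s p = (c : ℂ) • u p + (s : ℂ) • u q := by
  simp [planeRotation]

lemma planeRotation_right (hpq : p ≠ q) :
    planeRotation u p q c s q = (-s : ℂ) • u p + (c : ℂ) • u q := by
  simp [planeRotation, hpq.symm]

lemma planeRotation_of_ne {i : ℕ} (hp : i ≠ p) (hq : i ≠ q) :
    planeRotation u p q c s i = u i := by
  simp [planeRotation, hp, hq]

variable {c s}

lemma eq_planeRotation_left (hpq : p ≠ q) (hcs : c ^ 2 + s ^ 2 = 1) :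
    u p = (c : ℂ) • planeRotation u p q c s p - (s : ℂ) • planeRotation u p q c s q := by
  rw [planeRotation_left, planeRotation_right u c s hpq]
  have h : (c : ℂ) ^ 2 + (s : ℂ) ^ 2 = 1 := by exact_mod_cast hcs
  match_scalars
  · linear_combination -h
  · ring

lemma eq_planeRotation_right (hpq : p ≠ q) (hcs : c ^ 2 + s ^ 2 = 1) :
    u q = (s : ℂ) • planeRotation u p q c s p + (c : ℂ) • planeRotation u p q c s q := by
  rw [planeRotation_left, planeRotation_right u c s hpq]
  have h : (c : ℂ) ^ 2 + (s : ℂ) ^ 2 = 1 := by exact_mod_cast hcs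
  match_scalars
  · linear_combination -h
  · ring

variable {u}

lemma planeRotation_mem {S : Submodule ℂ H} (hu : ∀ i, u i ∈ S) (i : ℕ) :
    planeRotation u p q c s i ∈ S := by
  unfold planeRotation
  split_ifs
  · exact S.add_mem (S.smul_mem _ (hu _)) (S.smul_mem _ (hu _))
  · exact S.add_mem (S.smul_mem _ (hu _)) (S.smul_mem _ (hu _))
  · exact hu i

lemma orthonormal_planeRotation (hu : Orthonormal ℂ u) (hpq : p ≠ q)
    (hcs : c ^ 2 + s ^ 2 = 1) : Orthonormal ℂ (planeRotation u p q c s) := by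
  have h : (c : ℂ) ^ 2 + (s : ℂ) ^ 2 = 1 := by exact_mod_cast hcs
  have hqp := hpq.symm
  rw [orthonormal_iff_ite] at hu ⊢
  intro i j
  unfold planeRotation
  split_ifs <;>
    simp only [inner_add_left, inner_add_right, inner_smul_left, inner_smul_right, hu,
      Complex.conj_ofReal, map_neg] <;>
    grind

lemma inner_planeRotation_self {A : H →ₗ[ℂ] H} {μ : ℕ → ℝ} {t : ℝ}
    (hdiag : ∀ i, ⟪u i, A (u i)⟫_ℂ = (μ i : ℂ)) (hpq : p ≠ q)
    (hoff : ⟪u p, A (u q)⟫_ℂ = 0) (hoff' : ⟪u q, A (u p)⟫_ℂ = 0)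
    (hcs : c ^ 2 + s ^ 2 = 1) (ht : s ^ 2 * (μ q - μ p) = t) (i : ℕ) :
    ⟪planeRotation u p q c s i, A (planeRotation u p q c s i)⟫_ℂ
      = (transfer μ p q t i : ℂ) := by
  have h : (c : ℂ) ^ 2 + (s : ℂ) ^ 2 = 1 := by exact_mod_cast hcs
  have ht' : (s : ℂ) ^ 2 * ((μ q : ℂ) - μ p) = t := by exact_mod_cast ht
  by_cases hip : i = p
  · subst hip
    simp only [planeRotation_left, map_add, map_smul, inner_add_left, inner_add_right,
      inner_smul_left, inner_smul_right, hdiag, hoff, hoff', Complex.conj_ofReal, transfer,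
      if_pos, if_neg hpq]
    push_cast
    linear_combination (μ i : ℂ) * h + ht'
  by_cases hiq : i = q
  · subst hiq
    simp only [planeRotation_right u c s hpq, map_add, map_smul, map_neg, inner_add_left,
      inner_add_right, inner_smul_left, inner_smul_right, hdiag, hoff, hoff',
      Complex.conj_ofReal, transfer, if_pos, if_neg hip]
    push_cast
    linear_combination (μ i : ℂ) * h - ht'
  · simp [planeRotation_of_ne u c s hip hiq, transfer, hip, hiq, hdiag]

lemma inner_planeRotation_of_ne {A : H →ₗ[ℂ] H} {T : Set ℕ}
    (hoff : ∀ i ∈ T, ∀ j ∈ T, i ≠ j → ⟪u i, A (u j)⟫_ℂ = 0) (hp : p ∈ T) (hq : q ∈ T)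
    {i j : ℕ} (hi : i ∈ T) (hj : j ∈ T) (hij : i ≠ j)
    (h : i ≠ p ∧ j ≠ p ∨ i ≠ q ∧ j ≠ q) :
    ⟪planeRotation u p q c s i, A (planeRotation u p q c s j)⟫_ℂ = 0 := by
  unfold planeRotation
  split_ifs <;>
    (try simp only [map_add, map_smul, inner_add_left, inner_add_right, inner_smul_left,
      inner_smul_right]) <;>
    grind

end planeRotation

lemma exists_rotation_parameters {a b t : ℝ} (ht : 0 ≤ t) (htab : t ≤ b - a) :
    ∃ c s : ℝ, c ^ 2 + s ^ 2 = 1 ∧ s ^ 2 * (b - a) = t := by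
  have h0 : 0 ≤ t / (b - a) := div_nonneg ht (ht.trans htab)
  have h1 : t / (b - a) ≤ 1 := div_le_one_of_le₀ htab (ht.trans htab)
  refine ⟨√(1 - t / (b - a)), √(t / (b - a)), ?_, ?_⟩
  · rw [Real.sq_sqrt h0, Real.sq_sqrt (by linarith)]
    ring
  · rw [Real.sq_sqrt h0]
    rcases eq_or_ne (b - a) 0 with h | h
    · rw [h]
      linarith
    · field_simp

lemma sum_transfer (μ : ℕ → ℝ) (p q : ℕ) (t : ℝ) (n : ℕ) :
    ∑ i ∈ Finset.range n, transfer μ p q t i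
      = ∑ i ∈ Finset.range n, μ i + (if p < n then t else 0) - (if q < n then t else 0) := by
  simp [transfer, Finset.sum_add_distrib, Finset.sum_sub_distrib, Finset.sum_ite_eq']

/-- An orthonormal system `u` whose first `m` diagonal entries are already the prescribed
ones, while the compressions of `A` to the spans of `u m, …, u (N - 1)` and of
`u N, u (N + 1), …` are diagonal. -/
structure PartialDiagonal (A : H →ₗ[ℂ] H) (S : Submodule ℂ H) (d : ℕ → ℝ) (m N : ℕ)
    (u : ℕ → H) (μ : ℕ → ℝ) : Prop where
  mem : ∀ i, u i ∈ S
  orthonormal : Orthonormal ℂ u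
  inner_self : ∀ i, ⟪u i, A (u i)⟫_ℂ = (μ i : ℂ)
  inner_of_ne : ∀ i j, i ≠ j → m ≤ i → m ≤ j → (i < N ↔ j < N) → ⟪u i, A (u j)⟫_ℂ = 0
  eq_of_lt : ∀ i < m, μ i = d i
  unbounded : ∀ (C : ℝ) (n : ℕ), ∃ k ≥ n, C < μ k
  sum_le : ∀ n, ∑ i ∈ Finset.range n, μ i ≤ ∑ i ∈ Finset.range n, d i
  sum_eq : ∑ i ∈ Finset.range N, μ i = ∑ i ∈ Finset.range N, d i

lemma unbounded_transfer {μ : ℕ → ℝ} (h : ∀ (C : ℝ) (n : ℕ), ∃ k ≥ n, C < μ k) (p q : ℕ)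
    (t C : ℝ) (n : ℕ) : ∃ k ≥ n, C < transfer μ p q t k := by
  obtain ⟨k, hk, hC⟩ := h C (n + p + q + 1)
  refine ⟨k, by omega, ?_⟩
  simp [transfer, show k ≠ p by omega, show k ≠ q by omega, hC]

section PartialDiagonal

variable {A : H →ₗ[ℂ] H} {S : Submodule ℂ H} {d : ℕ → ℝ} {m N : ℕ} {u : ℕ → H} {μ : ℕ → ℝ}

lemma PartialDiagonal.sum_eq_of_lt (h : PartialDiagonal A S d m N u μ) :
    ∑ i ∈ Finset.range m, μ i = ∑ i ∈ Finset.range m, d i :=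
  Finset.sum_congr rfl fun i hi => h.eq_of_lt i (Finset.mem_range.1 hi)

/-- Produce one more prescribed diagonal entry by rotating inside the block `[m, N)`. -/
lemma PartialDiagonal.exists_succ (hd : Monotone d) (h : PartialDiagonal A S d m N u μ)
    (hmN : m < N) :
    ∃ u' μ', PartialDiagonal A S d (m + 1) N u' μ' ∧ (∀ i < m, u' i = u i) ∧
      (∀ i ≥ N, u' i = u i) ∧
      ∀ x : H, (∀ i < N, ⟪x, u' i⟫_ℂ = 0) → ∀ i < N, ⟪x, u i⟫_ℂ = 0 := by
  classical
  have hm1 : μ m ≤ d m := by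
    have := h.sum_le (m + 1)
    rw [Finset.sum_range_succ, Finset.sum_range_succ, h.sum_eq_of_lt] at this
    linarith
  have hex : ∃ q, m ≤ q ∧ q < N ∧ d m ≤ μ q := by
    by_contra! hcon
    have hlt : ∑ i ∈ Finset.range N, μ i < ∑ i ∈ Finset.range N, d i := by
      apply Finset.sum_lt_sum
      · intro i hi
        rcases lt_or_ge i m with him | him
        · exact (h.eq_of_lt i him).le
        · exact (hcon i him (Finset.mem_range.1 hi)).le.trans (hd him)
      · exact ⟨m, Finset.mem_range.2 hmN, hcon m le_rfl hmN⟩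
    exact hlt.ne h.sum_eq
  obtain ⟨hmq, hqN, hdq⟩ := Nat.find_spec hex
  have hmin : ∀ i, m ≤ i → i < Nat.find hex → μ i < d m := by
    intro i hi hlt
    have := Nat.find_min hex hlt
    by_contra! hcon
    exact this ⟨hi, hlt.trans hqN, hcon⟩
  generalize Nat.find hex = q at hmq hqN hdq hmin
  rcases hmq.eq_or_lt with rfl | hmq
  · refine ⟨u, μ, ⟨h.mem, h.orthonormal, h.inner_self, ?_, ?_, h.unbounded, h.sum_le,
      h.sum_eq⟩, fun _ _ => rfl, fun _ _ => rfl, fun _ hx => hx⟩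
    · exact fun i j hij hi hj => h.inner_of_ne i j hij (by omega) (by omega)
    · intro i hi
      rcases Nat.lt_succ_iff_lt_or_eq.1 hi with hi | rfl
      · exact h.eq_of_lt i hi
      · exact le_antisymm hm1 hdq
  obtain ⟨c, s, hcs, ht⟩ := exists_rotation_parameters (a := μ m) (b := μ q)
    (sub_nonneg.2 hm1) (sub_le_sub_right hdq _)
  have hoff : ∀ i ∈ Set.Ico m N, ∀ j ∈ Set.Ico m N, i ≠ j → ⟪u i, A (u j)⟫_ℂ = 0 :=
    fun i hi j hj hij => h.inner_of_ne i j hij hi.1 hj.1 (iff_of_true hi.2 hj.2)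
  have hmT : m ∈ Set.Ico m N := ⟨le_rfl, hmN⟩
  have hqT : q ∈ Set.Ico m N := ⟨hmq.le, hqN⟩
  refine ⟨planeRotation u m q c s, transfer μ m q (d m - μ m), ⟨planeRotation_mem h.mem,
    orthonormal_planeRotation h.orthonormal hmq.ne hcs,
    inner_planeRotation_self h.inner_self hmq.ne (hoff _ hmT _ hqT hmq.ne)
      (hoff _ hqT _ hmT hmq.ne') hcs ht, ?_, ?_, unbounded_transfer h.unbounded _ _ _, ?_, ?_⟩,
    ?_, ?_, ?_⟩
  · intro i j hij hi hj hiff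
    by_cases hiN : i < N
    · exact inner_planeRotation_of_ne hoff hmT hqT ⟨by omega, hiN⟩ ⟨by omega, hiff.1 hiN⟩ hij
        (Or.inl ⟨by omega, by omega⟩)
    · rw [planeRotation_of_ne u c s (by omega) (by omega),
        planeRotation_of_ne u c s (by omega) (by omega)]
      exact h.inner_of_ne i j hij (by omega) (by omega) hiff
  · intro i hi
    rcases Nat.lt_succ_iff_lt_or_eq.1 hi with hi | rfl
    · simp [transfer, hi.ne, (hi.trans hmq).ne, h.eq_of_lt i hi]
    · simp [transfer, hmq.ne]
  · intro n
    rw [sum_transfer]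
    have hn := h.sum_le n
    by_cases hqn : q < n
    · simpa [hqn, hmq.trans hqn] using hn
    by_cases hmn : m < n
    · simp only [hqn, hmn, if_true, if_false, sub_zero]
      obtain ⟨k, rfl⟩ : ∃ k, n = m + 1 + k := ⟨n - (m + 1), by omega⟩
      clear hn hmn
      induction k with
      | zero =>
        rw [add_zero, Finset.sum_range_succ, Finset.sum_range_succ, h.sum_eq_of_lt]
        linarith
      | succ k ih =>
        rw [← add_assoc, Finset.sum_range_succ, Finset.sum_range_succ]
        have h1 := ih (by omega)
        have h2 := hmin (m + 1 + k) (by omega) (by omega)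
        have h3 : d m ≤ d (m + 1 + k) := hd (by omega)
        linarith
    · simpa [hqn, hmn] using hn
  · rw [sum_transfer]
    simpa [hqN, hmN] using h.sum_eq
  · exact fun i hi => planeRotation_of_ne u c s hi.ne (hi.trans hmq).ne
  · exact fun i hi => planeRotation_of_ne u c s (by omega) (by omega)
  · intro x hx i hi
    by_cases him : i = m
    · rw [him, eq_planeRotation_left u hmq.ne hcs, inner_sub_right, inner_smul_right,
        inner_smul_right, hx m hmN, hx q hqN]
      simp
    by_cases hiq : i = q
    · rw [hiq, eq_planeRotation_right u hmq.ne hcs, inner_add_right, inner_smul_right,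
        inner_smul_right, hx m hmN, hx q hqN]
      simp
    · rw [← planeRotation_of_ne u c s him hiq]
      exact hx i hi

/-- The finite-dimensional Schur–Horn theorem for the block `[m, N)`. -/
lemma PartialDiagonal.exists_block (hd : Monotone d) (h : PartialDiagonal A S d m N u μ)
    (hmN : m ≤ N) :
    ∃ u' μ', PartialDiagonal A S d N N u' μ' ∧ (∀ i < m, u' i = u i) ∧
      (∀ i ≥ N, u' i = u i) ∧
      ∀ x : H, (∀ i < N, ⟪x, u' i⟫_ℂ = 0) → ∀ i < N, ⟪x, u i⟫_ℂ = 0 := by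
  obtain ⟨k, rfl⟩ := Nat.exists_eq_add_of_le hmN
  induction k generalizing m u μ with
  | zero => exact ⟨u, μ, h, fun _ _ => rfl, fun _ _ => rfl, fun _ hx => hx⟩
  | succ k ih =>
    obtain ⟨u₁, μ₁, h₁, hlt₁, hge₁, hx₁⟩ := h.exists_succ hd (by omega)
    rw [show m + (k + 1) = m + 1 + k by omega] at *
    obtain ⟨u₂, μ₂, h₂, hlt₂, hge₂, hx₂⟩ := ih h₁ (by omega)
    exact ⟨u₂, μ₂, h₂, fun i hi => (hlt₂ i (by omega)).trans (hlt₁ i hi),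
      fun i hi => (hge₂ i hi).trans (hge₁ i hi), fun x hx => hx₁ x (hx₂ x hx)⟩

/-- Raise the `m`-th diagonal entry, by a rotation of small angle with a vector `u K` far
out, until the entries in some block `[m, N)` have the prescribed sum. -/
lemma PartialDiagonal.exists_raise (h : PartialDiagonal A S d m m u μ) :
    ∃ N K c s u' μ', m < N ∧ N ≤ K ∧ c ^ 2 + s ^ 2 = 1 ∧ s ^ 2 ≤ 1 / 4 ∧
      u' = planeRotation u m K c s ∧ PartialDiagonal A S d m N u' μ' := by
  obtain ⟨K, hmK, hK⟩ := h.unbounded (μ m + 4 * (d m - μ m)) (m + 1)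
  obtain ⟨N, hN, hNmin⟩ := (Finset.Ioc m K).exists_min_image
    (fun n => ∑ i ∈ Finset.range n, d i - ∑ i ∈ Finset.range n, μ i)
    ⟨K, Finset.mem_Ioc.2 ⟨hmK, le_rfl⟩⟩
  obtain ⟨hmN, hNK⟩ := Finset.mem_Ioc.1 hN
  obtain ⟨t, ht⟩ : ∃ t, t = ∑ i ∈ Finset.range N, d i - ∑ i ∈ Finset.range N, μ i := ⟨_, rfl⟩
  rw [← ht] at hNmin
  have ht0 : 0 ≤ t := ht ▸ sub_nonneg.2 (h.sum_le N)
  have htm : t ≤ d m - μ m := by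
    have := hNmin (m + 1) (Finset.mem_Ioc.2 ⟨by omega, by omega⟩)
    rw [Finset.sum_range_succ, Finset.sum_range_succ, h.sum_eq_of_lt] at this
    linarith
  have hne : m ≠ K := by omega
  obtain ⟨c, s, hcs, hst⟩ := exists_rotation_parameters (a := μ m) (b := μ K) ht0
    (by linarith)
  have hoff : ∀ i ∈ Set.Ici m, ∀ j ∈ Set.Ici m, i ≠ j → ⟪u i, A (u j)⟫_ℂ = 0 :=
    fun i hi j hj hij => h.inner_of_ne i j hij hi hj
      (iff_of_false (not_lt.2 hi) (not_lt.2 hj))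
  have hmT : m ∈ Set.Ici m := Set.self_mem_Ici
  have hKT : K ∈ Set.Ici m := show m ≤ K by omega
  refine ⟨N, K, c, s, _, transfer μ m K t, hmN, hNK, hcs, ?_, rfl, planeRotation_mem h.mem,
    orthonormal_planeRotation h.orthonormal hne hcs,
    inner_planeRotation_self h.inner_self hne (hoff _ hmT _ hKT hne)
      (hoff _ hKT _ hmT hne.symm) hcs hst, ?_, ?_, unbounded_transfer h.unbounded _ _ _, ?_, ?_⟩
  · by_contra! hcon
    nlinarith
  · exact fun i j hij hi hj hiff => inner_planeRotation_of_ne hoff hmT hKT hi hj hij (by omega)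
  · intro i hi
    simp [transfer, hi.ne, show i ≠ K by omega, h.eq_of_lt i hi]
  · intro n
    rw [sum_transfer]
    have hn := h.sum_le n
    by_cases hKn : K < n
    · simpa [hKn, show m < n by omega] using hn
    by_cases hmn : m < n
    · have := hNmin n (Finset.mem_Ioc.2 ⟨hmn, by omega⟩)
      simp only [hKn, hmn, if_true, if_false]
      linarith
    · simpa [hKn, hmn] using hn
  · rw [sum_transfer]
    simp only [hmN, not_lt.2 hNK, if_true, if_false]
    linarith

/-- Complete one block. A functional vanishing on the finished vectors of the new system is
at most half as large on `u m` as on some vector `u' K`. -/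
lemma PartialDiagonal.exists_next (hd : Monotone d) (h : PartialDiagonal A S d m m u μ) :
    ∃ N u' μ', m < N ∧ PartialDiagonal A S d N N u' μ' ∧ (∀ i < m, u' i = u i) ∧
      ∃ K ≥ N, (∀ i ≥ N, i ≠ K → u' i = u i) ∧
        ∀ x : H, (∀ i < N, ⟪x, u' i⟫_ℂ = 0) →
          (∀ i < N, i ≠ m → ⟪x, u i⟫_ℂ = 0) ∧
          ‖⟪x, u m⟫_ℂ‖ ≤ 1 / 2 * ‖⟪x, u' K⟫_ℂ‖ ∧ ‖⟪x, u K⟫_ℂ‖ ≤ ‖⟪x, u' K⟫_ℂ‖ := by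
  obtain ⟨N, K, c, s, u₁, μ₁, hmN, hNK, hcs, hs, hu₁, h₁⟩ := h.exists_raise
  obtain ⟨u₂, μ₂, h₂, hlt, hge, hx₂⟩ := h₁.exists_block hd hmN.le
  have hne : m ≠ K := by omega
  refine ⟨N, u₂, μ₂, hmN, h₂, ?_, K, hNK, ?_, ?_⟩
  · intro i hi
    rw [hlt i hi, hu₁, planeRotation_of_ne u c s (by omega) (by omega)]
  · intro i hi hiK
    rw [hge i hi, hu₁, planeRotation_of_ne u c s (by omega) hiK]
  · intro x hx
    have hx₁ := hx₂ x hx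
    refine ⟨fun i hi him => ?_, ?_, ?_⟩
    · rw [← planeRotation_of_ne u c s him (show i ≠ K by omega), ← hu₁]
      exact hx₁ i hi
    · rw [eq_planeRotation_left u hne hcs, ← hu₁, inner_sub_right, inner_smul_right,
        inner_smul_right, hx₁ m hmN, hge K hNK, mul_zero, zero_sub, norm_neg, norm_mul,
        Complex.norm_real]
      gcongr
      exact abs_le_of_sq_le_sq (by linarith) (by norm_num)
    · rw [eq_planeRotation_right u hne hcs, ← hu₁, inner_add_right, inner_smul_right,
        inner_smul_right, hx₁ m hmN, hge K hNK, mul_zero, zero_add, norm_mul,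
        Complex.norm_real]
      refine mul_le_of_le_one_left (norm_nonneg _) ?_
      exact abs_le_of_sq_le_sq (by nlinarith [sq_nonneg s]) (by norm_num)

/-- Iterating `PartialDiagonal.exists_next` yields an orthonormal system with the prescribed
diagonal which is as total as the original one. -/
theorem PartialDiagonal.exists_orthonormal (hd : Monotone d)
    (h : PartialDiagonal A S d 0 0 u μ) :
    ∃ e : ℕ → H, Orthonormal ℂ e ∧ (∀ i, e i ∈ S) ∧ (∀ i, ⟪e i, A (e i)⟫_ℂ = (d i : ℂ)) ∧
      ∀ x : H, (∀ i, ⟪x, e i⟫_ℂ = 0) → ∀ i, ⟪x, u i⟫_ℂ = 0 := by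
  let State := {σ : ℕ × (ℕ → H) × (ℕ → ℝ) // PartialDiagonal A S d σ.1 σ.1 σ.2.1 σ.2.2}
  have hstep : ∀ σ : State, ∃ τ : State, σ.1.1 < τ.1.1 ∧
      (∀ i < σ.1.1, τ.1.2.1 i = σ.1.2.1 i) ∧
      ∃ K ≥ τ.1.1, (∀ i ≥ τ.1.1, i ≠ K → τ.1.2.1 i = σ.1.2.1 i) ∧
        ∀ x : H, (∀ i < τ.1.1, ⟪x, τ.1.2.1 i⟫_ℂ = 0) →
          (∀ i < τ.1.1, i ≠ σ.1.1 → ⟪x, σ.1.2.1 i⟫_ℂ = 0) ∧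
          ‖⟪x, σ.1.2.1 σ.1.1⟫_ℂ‖ ≤ 1 / 2 * ‖⟪x, τ.1.2.1 K⟫_ℂ‖ ∧
          ‖⟪x, σ.1.2.1 K⟫_ℂ‖ ≤ ‖⟪x, τ.1.2.1 K⟫_ℂ‖ := by
    rintro ⟨⟨m, w, ν⟩, hσ⟩
    obtain ⟨N, u', μ', hN, h', hrest⟩ := hσ.exists_next hd
    exact ⟨⟨⟨N, u', μ'⟩, h'⟩, hN, hrest⟩
  choose next hlt hfrozen hnext using hstep
  let seq : ℕ → State := fun k => next^[k] ⟨⟨0, u, μ⟩, h⟩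
  have hseq : ∀ k, seq (k + 1) = next (seq k) := fun k => Function.iterate_succ_apply' _ _ _
  obtain ⟨M, hM⟩ : ∃ M : ℕ → ℕ, ∀ k, M k = (seq k).1.1 := ⟨_, fun _ => rfl⟩
  obtain ⟨w, hw⟩ : ∃ w : ℕ → ℕ → H, ∀ k, w k = (seq k).1.2.1 := ⟨_, fun _ => rfl⟩
  obtain ⟨ν, hν⟩ : ∃ ν : ℕ → ℕ → ℝ, ∀ k, ν k = (seq k).1.2.2 := ⟨_, fun _ => rfl⟩
  have hP : ∀ k, PartialDiagonal A S d (M k) (M k) (w k) (ν k) := fun k => by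
    rw [hM, hw, hν]
    exact (seq k).2
  have hMlt : ∀ k, M k < M (k + 1) := fun k => by
    rw [hM, hM, hseq]
    exact hlt _
  have hwfrozen : ∀ k, ∀ i < M k, w (k + 1) i = w k i := fun k => by
    rw [hM, hw, hw, hseq]
    exact hfrozen _
  have hwnext : ∀ k, ∃ K ≥ M (k + 1), (∀ i ≥ M (k + 1), i ≠ K → w (k + 1) i = w k i) ∧
      ∀ x : H, (∀ i < M (k + 1), ⟪x, w (k + 1) i⟫_ℂ = 0) →
        (∀ i < M (k + 1), i ≠ M k → ⟪x, w k i⟫_ℂ = 0) ∧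
        ‖⟪x, w k (M k)⟫_ℂ‖ ≤ 1 / 2 * ‖⟪x, w (k + 1) K⟫_ℂ‖ ∧
        ‖⟪x, w k K⟫_ℂ‖ ≤ ‖⟪x, w (k + 1) K⟫_ℂ‖ := fun k => by
    simp only [hM, hw, hseq]
    exact hnext _
  have hMmono : StrictMono M := strictMono_nat_of_lt_succ hMlt
  have hlive : ∀ i, i < M (i + 1) := fun i => hMmono.le_apply (x := i + 1)
  have hstable : ∀ k l i, k ≤ l → i < M k → w l i = w k i := by
    intro k l i hkl hi
    induction l, hkl using Nat.le_induction with
    | base => rfl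
    | succ l hl ih => rw [hwfrozen l i (hi.trans_le (hMmono.monotone hl)), ih]
  have he : ∀ k i, i < M k → w (i + 1) i = w k i := by
    intro k i hi
    rcases le_total k (i + 1) with hk | hk
    · exact hstable k (i + 1) i hk hi
    · exact (hstable (i + 1) k i hk (hlive i)).symm
  refine ⟨fun i => w (i + 1) i, ?_, fun i => (hP _).mem i, ?_, ?_⟩
  · rw [orthonormal_iff_ite]
    intro i j
    have hi : i < M (i + j + 1) := (hlive i).trans_le (hMmono.monotone (by omega))
    have hj : j < M (i + j + 1) := (hlive j).trans_le (hMmono.monotone (by omega))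
    simp only [he _ _ hi, he _ _ hj]
    exact orthonormal_iff_ite.1 (hP _).orthonormal i j
  · intro i
    rw [(hP (i + 1)).inner_self, (hP (i + 1)).eq_of_lt i (hlive i)]
  · intro x hx
    have hx' : ∀ k, ∀ i < M k, ⟪x, w k i⟫_ℂ = 0 := fun k i hi => by
      rw [← he k i hi]
      exact hx i
    have hbound : ∀ r k j, ‖⟪x, w k j⟫_ℂ‖ ≤ ‖x‖ * (1 / 2) ^ r := by
      intro r
      induction r with
      | zero =>
        intro k j
        simpa [(hP k).orthonormal.1 j] using norm_inner_le_norm (𝕜 := ℂ) x (w k j)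
      | succ r ih =>
        suffices H : ∀ n k j, j < M k + n → ‖⟪x, w k j⟫_ℂ‖ ≤ ‖x‖ * (1 / 2) ^ (r + 1) from
          fun k j => H (j + 1) k j (by omega)
        intro n
        induction n with
        | zero =>
          intro k j hj
          rw [hx' k j hj, norm_zero]
          positivity
        | succ n ihn =>
          intro k j hj
          obtain ⟨K, hK, hsame, hcap⟩ := hwnext k
          obtain ⟨hzero, hhalf, hle⟩ := hcap x (hx' (k + 1))
          have hk := hMlt k
          by_cases hjM : j = M k
          · rw [hjM, pow_succ]
            linarith [ih (k + 1) K]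
          by_cases hjN : j < M (k + 1)
          · rw [hzero j hjN hjM, norm_zero]
            positivity
          by_cases hjK : j = K
          · subst hjK
            exact hle.trans (ihn (k + 1) j (by omega))
          · rw [← hsame j (not_lt.1 hjN) hjK]
            exact ihn (k + 1) j (by omega)
    intro i
    have hlim : Filter.Tendsto (fun r : ℕ => ‖x‖ * (1 / 2 : ℝ) ^ r) Filter.atTop (nhds 0) := by
      simpa using (tendsto_pow_atTop_nhds_zero_of_lt_one (r := (1 / 2 : ℝ))
        (by norm_num) (by norm_num)).const_mul ‖x‖
    have hw0 : w 0 = u := hw 0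
    have := ge_of_tendsto' hlim fun r => hbound r 0 i
    rw [hw0] at this
    exact norm_le_zero_iff.1 this

end PartialDiagonal

lemma exists_linearMap_smul {v : ℕ → H} (hv : LinearIndependent ℂ v) (lam : ℕ → ℝ) :
    ∃ A : H →ₗ[ℂ] H, ∀ j, A (v j) = (lam j : ℂ) • v j := by
  obtain ⟨A, hA⟩ := LinearMap.exists_extend
    ((Module.Basis.span hv).constr ℂ fun j => (lam j : ℂ) • v j)
  refine ⟨A, fun j => ?_⟩
  have h := LinearMap.congr_fun hA (Module.Basis.span hv j)
  rw [Module.Basis.constr_basis] at h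
  simpa [Module.Basis.span_apply] using h

lemma hasSum_diagonal {v : ℕ → H} (hv : Orthonormal ℂ v) {lam : ℕ → ℝ} {A : H →ₗ[ℂ] H}
    (hA : ∀ j, A (v j) = (lam j : ℂ) • v j) {f : H}
    (hf : f ∈ Submodule.span ℂ (Set.range v)) :
    HasSum (fun j => ((lam j : ℂ) * ⟪v j, f⟫_ℂ) • v j) (A f) := by
  induction hf using Submodule.span_induction with
  | mem f hf =>
    obtain ⟨k, rfl⟩ := hf
    have := hasSum_single (f := fun j => ((lam j : ℂ) * ⟪v j, v k⟫_ℂ) • v j) k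
      fun j hj => by simp [hv.2 hj]
    simpa [hA, orthonormal_iff_ite.1 hv, hv.1 k] using this
  | zero => simp
  | add f g _ _ hf hg => simpa [inner_add_right, mul_add, add_smul] using hf.add hg
  | smul a f _ hf =>
    simpa [inner_smul_right, smul_smul, mul_left_comm] using hf.const_smul a

end SchurHorn

/-- The unbounded Schur–Horn theorem: let $E = \mathrm{diag}\,\lambda$ act by
$Ef = \sum_j \lambda_j \langle f, v_j\rangle v_j$, where $\{v_j\}$ is an orthonormal
basis of the Hilbert space and $\{\lambda_j\}$ is nondecreasing and unbounded.  If
$\{d_i\}$ is nondecreasing and unbounded with $\sum_{i<n}\lambda_i \le \sum_{i<n} d_i$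
for all $n$, then there is an orthonormal basis $\{e_i\}$, each $e_i$ a finite linear
combination of the $v_j$ (hence in the domain of $E$), with
$\langle Ee_i, e_i\rangle = d_i$ for all $i$. -/
theorem stmt_15 {H : Type*} [NormedAddCommGroup H] [InnerProductSpace ℂ H] [CompleteSpace H]
    (v : ℕ → H) (hv : Orthonormal ℂ v)
    (hvtot : (Submodule.span ℂ (Set.range v)).topologicalClosure = ⊤)
    (lam : ℕ → ℝ) (hlam : Monotone lam) (hlamub : ¬ BddAbove (Set.range lam))
    (d : ℕ → ℝ) (hd : Monotone d) (hdub : ¬ BddAbove (Set.range d))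
    (hmaj : ∀ n, ∑ i ∈ Finset.range n, lam i ≤ ∑ i ∈ Finset.range n, d i) :
    ∃ e : ℕ → H, Orthonormal ℂ e ∧
      (Submodule.span ℂ (Set.range e)).topologicalClosure = ⊤ ∧
      (∀ i, e i ∈ Submodule.span ℂ (Set.range v)) ∧
      ∀ i, ⟪e i, ∑' j, ((lam j : ℂ) * ⟪v j, e i⟫_ℂ) • v j⟫_ℂ = (d i : ℂ) := by
  obtain ⟨A, hA⟩ := SchurHorn.exists_linearMap_smul hv.linearIndependent lam
  have hstart : SchurHorn.PartialDiagonal A (Submodule.span ℂ (Set.range v)) d 0 0 v lam := by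
    refine ⟨fun i => Submodule.subset_span ⟨i, rfl⟩, hv, fun i => ?_, fun i j hij _ _ _ => ?_,
      fun i hi => absurd hi (Nat.not_lt_zero i), fun C n => ?_, hmaj, by simp⟩
    · simp [hA, hv.1 i]
    · simp [hA, hv.2 hij]
    · obtain ⟨_, ⟨k, rfl⟩, hk⟩ := not_bddAbove_iff.1 hlamub C
      exact ⟨max n k, le_max_left _ _, hk.trans_le (hlam (le_max_right _ _))⟩
  obtain ⟨e, he, hmem, hdiag, htot⟩ := hstart.exists_orthonormal hd
  refine ⟨e, he, ?_, hmem, fun i => ?_⟩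
  · rw [Submodule.topologicalClosure_eq_top_iff, Submodule.eq_bot_iff] at hvtot ⊢
    intro x hx
    rw [Submodule.mem_orthogonal'] at hx
    refine hvtot x ?_
    have hxv := htot x fun i => hx _ (Submodule.subset_span ⟨i, rfl⟩)
    rw [Submodule.mem_orthogonal']
    intro y hy
    induction hy using Submodule.span_induction with
    | mem y hy =>
      obtain ⟨k, rfl⟩ := hy
      exact hxv k
    | zero => simp
    | add y z _ _ hy hz => simp [inner_add_right, hy, hz]
    | smul a y _ hy => simp [inner_smul_right, hy]
  · rw [(SchurHorn.hasSum_diagonal hv hA (hmem i)).tsum_eq, hdiag]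
end
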